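/- The set of tree-decorated rooted planar maps with e + m edges, decorated by a tree with m edges and rooted on the tree, is in bijection with the Cartesian product of the set of rooted plane trees with m edges and the set of maps with a simple boundary of perimeter 2m and e interior edges. -/

import Mathlib

/-- A rooted combinatorial map, encoded by permutations of its darts (half-edges):
`sigma` is the counterclockwise rotation of the darts around each vertex, `alpha` is the
fixed-point-free involution exchanging the two darts of each edge, the action generated by
them is transitive (connectedness), and `root` is the marked oriented edge (dart). -/
structure RootedMap where
  nd : ℕ
  sigma : Equiv.Perm (Fin nd)
  alpha : Equiv.Perm (Fin nd)
  alpha_invol : ∀ d, alpha (alpha d) = d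
  alpha_fixfree : ∀ d, alpha d ≠ d
  root : Fin nd
  conn : ∀ d d' : Fin nd,
    ∃ g ∈ Subgroup.closure ({sigma, alpha} : Set (Equiv.Perm (Fin nd))), g d = d'

namespace RootedMap

/-- The number of cycles (orbits) of a permutation, fixed points included. -/
noncomputable def numCycles {n : ℕ} (π : Equiv.Perm (Fin n)) : ℕ :=
  Nat.card (Quot π.SameCycle)

/-- The face permutation of a map. -/
def phi (M : RootedMap) : Equiv.Perm (Fin M.nd) := M.sigma * M.alpha

noncomputable def vertices (M : RootedMap) : ℕ := numCycles M.sigma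
def edges (M : RootedMap) : ℕ := M.nd / 2
noncomputable def faces (M : RootedMap) : ℕ := numCycles M.phi

/-- Planarity (genus 0) via Euler's formula. -/
def Planar (M : RootedMap) : Prop := M.vertices + M.faces = M.edges + 2

/-- Two darts lie on the same vertex. -/
def sameVertex (M : RootedMap) (d d' : Fin M.nd) : Prop := M.sigma.SameCycle d d'

/-- The degree of the face containing a dart `d`: the length of its `phi`-cycle. -/
noncomputable def faceDegreeAt (M : RootedMap) (d : Fin M.nd) : ℕ :=
  Nat.card {d' : Fin M.nd // M.phi.SameCycle d d'}

/-- All faces have degree `q`. -/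
def IsQAngulation (M : RootedMap) (q : ℕ) : Prop :=
  ∀ d : Fin M.nd, M.faceDegreeAt d = q

/-- The degree of the root face (the external face of a map with a boundary). -/
noncomputable def rootFaceDegree (M : RootedMap) : ℕ := M.faceDegreeAt M.root

/-- The boundary (root face) is simple: the face cycle of the root visits every vertex at
most once. -/
def SimpleBoundary (M : RootedMap) : Prop :=
  ∀ d d' : Fin M.nd, M.phi.SameCycle M.root d → M.phi.SameCycle M.root d' →
    M.sameVertex d d' → d = d'

/-- All faces except possibly the root face have degree `q`. -/
def IsQAngulationWithBoundary (M : RootedMap) (q : ℕ) : Prop :=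
  ∀ d : Fin M.nd, ¬ M.phi.SameCycle M.root d → M.faceDegreeAt d = q

/-- `S` (a set of darts, closed under `alpha`) is a subtree of `M`: the corresponding
submap is connected and the number of its vertices exceeds its number of edges by one. -/
def IsTreeSub (M : RootedMap) (S : Finset (Fin M.nd)) : Prop :=
  (∀ d ∈ S, M.alpha d ∈ S) ∧
  (∀ d ∈ S, ∀ d' ∈ S,
    Relation.ReflTransGen
      (fun a b => a ∈ S ∧ b ∈ S ∧ (M.sameVertex a b ∨ b = M.alpha a)) d d') ∧
  Nat.card (Quot (fun a b : {d : Fin M.nd // d ∈ S} => M.sameVertex a.1 b.1))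
    = S.card / 2 + 1

/-- `S` is a spanning subtree of `M`: a subtree touching every vertex. -/
def IsSpanningTree (M : RootedMap) (S : Finset (Fin M.nd)) : Prop :=
  M.IsTreeSub S ∧ ∀ d : Fin M.nd, ∃ d' ∈ S, M.sameVertex d d'

/-- Isomorphism of rooted maps: a root-preserving relabelling of darts commuting with the
structure permutations. -/
def Iso (M M' : RootedMap) : Prop :=
  ∃ f : Fin M.nd ≃ Fin M'.nd,
    (∀ d, f (M.sigma d) = M'.sigma (f d)) ∧
    (∀ d, f (M.alpha d) = M'.alpha (f d)) ∧
    f M.root = M'.root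

/-- Isomorphism of decorated rooted maps (the decoration is a set of darts). -/
def DecIso (M M' : RootedMap) (S : Finset (Fin M.nd)) (S' : Finset (Fin M'.nd)) : Prop :=
  ∃ f : Fin M.nd ≃ Fin M'.nd,
    (∀ d, f (M.sigma d) = M'.sigma (f d)) ∧
    (∀ d, f (M.alpha d) = M'.alpha (f d)) ∧
    f M.root = M'.root ∧
    ∀ d, d ∈ S ↔ f d ∈ S'

end RootedMap


/-- A rooted plane tree: an ordered list of subtrees. -/
inductive PlaneTree : Type
  | node : List PlaneTree → PlaneTree

/-- The number of edges of a plane tree. -/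
def PlaneTree.edges : PlaneTree → ℕ
  | node ts => ts.attach.foldr (fun t acc => PlaneTree.edges t.1 + 1 + acc) 0
decreasing_by
  simp only [PlaneTree.node.sizeOf_spec]
  have := List.sizeOf_lt_of_mem t.2
  omega

open RootedMap

section TreeGluing

open Equiv.Perm

/-! ### First return maps and cycles of permutations -/

namespace Equiv.Perm

/-- `FirstHit σ S x y`: the first point of `S` met by the sequence `x, σ x, σ² x, …` is `y`. -/
inductive FirstHit {D : Type*} (σ : Equiv.Perm D) (S : Set D) : D → D → Prop
  | here {x : D} : x ∈ S → FirstHit σ S x x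
  | step {x y : D} : x ∉ S → FirstHit σ S (σ x) y → FirstHit σ S x y

namespace FirstHit

variable {D E : Type*} {σ : Equiv.Perm D} {S : Set D}

theorem mem {x y : D} (h : FirstHit σ S x y) : y ∈ S := by
  induction h with
  | here h => exact h
  | step _ _ ih => exact ih

theorem unique {x y z : D} (h : FirstHit σ S x y) (h' : FirstHit σ S x z) : y = z := by
  induction h with
  | here hx =>
    cases h' with
    | here => rfl
    | step hn _ => exact absurd hx hn
  | step hn _ ih =>
    cases h' with
    | here hx => exact absurd hx hn
    | step _ h' => exact ih h'

theorem sameCycle {x y : D} (h : FirstHit σ S x y) : σ.SameCycle x y := by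
  induction h with
  | here => exact SameCycle.refl _ _
  | step _ _ ih => exact sameCycle_apply_left.1 ih

theorem exists_of_pow_mem (n : ℕ) : ∀ x : D, (σ ^ n) x ∈ S → ∃ y, FirstHit σ S x y := by
  induction n with
  | zero => exact fun x hx => ⟨x, .here (by simpa using hx)⟩
  | succ n ih =>
    intro x hx
    by_cases hxS : x ∈ S
    · exact ⟨x, .here hxS⟩
    · obtain ⟨y, hy⟩ := ih (σ x) (by simpa [pow_succ] using hx)
      exact ⟨y, .step hxS hy⟩

theorem exists_of_mem [Finite D] {x : D} (hx : x ∈ S) : ∃ y, FirstHit σ S (σ x) y := by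
  obtain ⟨n, hn⟩ := (sameCycle_apply_left.2 (SameCycle.refl σ x)).exists_nat_pow_eq
  exact exists_of_pow_mem n _ (by rwa [hn])

theorem map {σ' : Equiv.Perm E} {S' : Set E} (f : D → E) (hf : ∀ x, f (σ x) = σ' (f x))
    (hS : ∀ x, x ∈ S ↔ f x ∈ S') {x y : D} (h : FirstHit σ S x y) :
    FirstHit σ' S' (f x) (f y) := by
  induction h with
  | here h => exact .here ((hS _).1 h)
  | step hn _ ih => exact .step (fun h => hn ((hS _).2 h)) (hf _ ▸ ih)

/-- The last point of `S` before `y` is the one whose first return is `y`. -/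
theorem of_inv {x a y : D} (h : FirstHit σ⁻¹ S x a) (hy : FirstHit σ S (σ x) y) :
    FirstHit σ S (σ a) y := by
  induction h with
  | here => exact hy
  | step hn _ ih => exact ih (by simpa using FirstHit.step hn hy)

theorem mem_of_closed {X : Set D} (hX : ∀ x ∈ X, σ x ∈ X) {x y : D} (h : FirstHit σ S x y)
    (hx : x ∈ X) : y ∈ X := by
  induction h with
  | here => exact hx
  | step _ _ ih => exact ih (hX _ hx)

end FirstHit

section FirstReturn

variable {D ι : Type*} [Finite D] {σ : Equiv.Perm D} {s : ι → D} {π : Equiv.Perm ι}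

/-- The cycles of a first return permutation are the traces of the original cycles. -/
theorem sameCycle_iff_of_firstHit (hs : Function.Injective s)
    (h : ∀ i, FirstHit σ (Set.range s) (σ (s i)) (s (π i))) (i j : ι) :
    σ.SameCycle (s i) (s j) ↔ π.SameCycle i j := by
  constructor
  · have key : ∀ (n : ℕ) (x : D) (i : ι), (σ ^ n) x = s j →
        FirstHit σ (Set.range s) x (s i) → π.SameCycle i j := by
      intro n
      induction n with
      | zero =>
        intro x i hx hi
        have hxj : x = s j := by simpa using hx
        subst hxj
        rw [hs (hi.unique (.here ⟨j, rfl⟩))]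
      | succ n ih =>
        intro x i hx hi
        have hx' : (σ ^ n) (σ x) = s j := by simpa [pow_succ] using hx
        generalize hz : s i = z at hi
        cases hi with
        | here => subst hz; exact sameCycle_apply_left.1 (ih _ _ hx' (h i))
        | step _ hi => subst hz; exact ih _ _ hx' hi
    intro hij
    obtain ⟨n, hn⟩ := hij.exists_nat_pow_eq
    exact key n _ _ hn (.here ⟨i, rfl⟩)
  · have step : ∀ i, σ.SameCycle (s i) (s (π i)) := fun i =>
      sameCycle_apply_left.1 (h i).sameCycle
    have hι : Finite ι := Finite.of_injective s hs
    intro hij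
    obtain ⟨n, rfl⟩ := hij.exists_nat_pow_eq
    clear hij
    induction n with
    | zero => exact SameCycle.refl _ _
    | succ n ih => simpa [pow_succ'] using ih.trans (step _)

theorem exists_firstReturn (σ : Equiv.Perm D) (S : Set D) :
    ∃ r : Equiv.Perm S, ∀ d : S, FirstHit σ S (σ d) (r d) := by
  have hex : ∀ d : S, ∃ y : S, FirstHit σ S (σ d) y := fun d => by
    obtain ⟨y, hy⟩ := FirstHit.exists_of_mem (σ := σ) d.2
    exact ⟨⟨y, hy.mem⟩, hy⟩
  choose r hr using hex
  have hsurj : Function.Surjective r := by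
    intro y
    obtain ⟨a, ha⟩ := FirstHit.exists_of_mem (σ := σ⁻¹) y.2
    have hy : FirstHit σ S (σ (σ⁻¹ y)) y := by
      have : σ (σ⁻¹ (y : D)) = y := by simp
      rw [this]
      exact .here y.2
    exact ⟨⟨a, ha.mem⟩, Subtype.ext ((hr _).unique (ha.of_inv hy))⟩
  exact ⟨Equiv.ofBijective r (Finite.surjective_iff_bijective.1 hsurj), hr⟩

end FirstReturn

/-- A cycle of length `N` through `a` is parametrized by `Fin N`. -/
theorem exists_cyclic_parametrization {D : Type*} [Finite D] (c : Equiv.Perm D) (a : D) {N : ℕ}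
    [NeZero N] (hN : Nat.card {d // c.SameCycle a d} = N) :
    ∃ b : Fin N → D, Function.Injective b ∧ Set.range b = {d | c.SameCycle a d} ∧ b 0 = a ∧
      ∀ i, c (b i) = b (i + 1) := by
  classical
  have := Fintype.ofFinite D
  set s : Finset D := Finset.univ.filter fun d => c.SameCycle a d with hs
  have hmem : ∀ d, d ∈ s ↔ c.SameCycle a d := fun d => by simp [hs]
  have hcard : s.card = N := by
    rw [← hN, Nat.card_eq_fintype_card, Fintype.card_subtype]
  have hcyc : c.IsCycleOn (s : Set D) := by
    refine ⟨⟨fun x hx => ?_, c.injective.injOn, fun x hx => ⟨c⁻¹ x, ?_, by simp⟩⟩,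
      fun x hx y hy => ?_⟩
    · simpa [hmem] using hx
    · simpa [hmem] using hx
    · simp only [Finset.mem_coe, hmem] at hx hy
      exact hx.symm.trans hy
  have ha : a ∈ s := (hmem a).2 (SameCycle.refl _ _)
  refine ⟨fun i => (c ^ (i : ℕ)) a, fun i j hij => ?_, ?_, by simp, fun i => ?_⟩
  · have := (hcyc.pow_apply_eq_pow_apply ha).1 hij
    rw [hcard] at this
    exact Fin.ext (Nat.ModEq.eq_of_lt_of_lt this i.2 j.2)
  · ext d
    constructor
    · rintro ⟨i, rfl⟩
      exact (sameCycle_pow_right).2 (SameCycle.refl _ _)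
    · intro hd
      obtain ⟨n, hn, rfl⟩ := hcyc.exists_pow_eq ha ((hmem d).2 hd)
      exact ⟨⟨n, hcard ▸ hn⟩, rfl⟩
  · change c ((c ^ (i : ℕ)) a) = (c ^ ((i + 1 : Fin N) : ℕ)) a
    rw [← Perm.mul_apply, ← pow_succ', hcyc.pow_apply_eq_pow_apply ha, hcard, Fin.val_add]
    have h1 : ((1 : Fin N) : ℕ) ≡ 1 [MOD N] := by
      rw [Fin.val_one']; exact Nat.mod_modEq _ _
    exact ((Nat.mod_modEq _ _).trans (h1.add_left _)).symm

end Equiv.Perm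

theorem Fin.cyclic_induction {N : ℕ} [NeZero N] {p : Fin N → Prop} (h0 : p 0)
    (hs : ∀ i, p i → p (i + 1)) (i : Fin N) : p i := by
  obtain ⟨k, rfl⟩ := Nat.exists_eq_succ_of_ne_zero (NeZero.ne N)
  induction i using Fin.induction with
  | zero => exact h0
  | succ i ih => simpa using hs _ ih

theorem Fin.cyclic_induction_from {N : ℕ} [NeZero N] {p : Fin N → Prop} (i : Fin N) (h0 : p i)
    (hs : ∀ i, p i → p (i + 1)) (j : Fin N) : p j := by
  have := Fin.cyclic_induction (p := fun k => p (i + k)) (by simpa using h0)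
    (fun k hk => by rw [← add_assoc]; exact hs _ hk) (j - i)
  simpa using this

/-- Classes of an equivalence relation either meet `A` or avoid it. -/
theorem Nat.card_quot_eq_add {X : Type*} [Finite X] {r : X → X → Prop} (hr : Equivalence r)
    (A : Set X) :
    Nat.card (Quot r) = Nat.card (Quot fun a b : A => r a b) +
      Nat.card (Quot fun a b : {x // ∀ a ∈ A, ¬ r a x} => r a b) := by
  rw [← Nat.card_sum]
  symm
  refine Nat.card_congr (Equiv.ofBijective (Sum.elim
    (Quot.map (fun a : A => (a : X)) fun _ _ h => h)
    (Quot.map (fun a : {x // ∀ a ∈ A, ¬ r a x} => (a : X)) fun _ _ h => h)) ⟨?_, ?_⟩)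
  · have exact' : ∀ {x y : X}, Quot.mk r x = Quot.mk r y → r x y := fun h =>
      (hr.eqvGen_iff).1 (Quot.eqvGen_exact h)
    rintro (⟨⟨x, hx⟩⟩ | ⟨⟨x, hx⟩⟩) (⟨⟨y, hy⟩⟩ | ⟨⟨y, hy⟩⟩) h
    · exact congrArg Sum.inl (Quot.sound (exact' h))
    · exact absurd (exact' h) (hy _ hx)
    · exact absurd (hr.symm (exact' h)) (hx _ hy)
    · exact congrArg Sum.inr (Quot.sound (exact' h))
  · rintro ⟨x⟩
    by_cases h : ∃ a ∈ A, r a x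
    · obtain ⟨a, ha, hax⟩ := h
      exact ⟨Sum.inl (Quot.mk _ ⟨a, ha⟩), Quot.sound hax⟩
    · push Not at h
      exact ⟨Sum.inr (Quot.mk _ ⟨x, h⟩), rfl⟩

/-- A relation between `A` and `T × B` that is total on both sides and compatible with
relations on `A` and `B` induces a bijection of quotients. -/
theorem nonempty_quot_equiv_prod_quot {A B T : Type*} {rA : A → A → Prop} {rB : B → B → Prop}
    (reflA : ∀ a, rA a a) (reflB : ∀ b, rB b b) (R : A → T → B → Prop)
    (exists_right : ∀ a, ∃ t b, R a t b) (exists_left : ∀ t b, ∃ a, R a t b)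
    (right_unique : ∀ {a a' t t' b b'}, rA a a' → R a t b → R a' t' b' → t = t' ∧ rB b b')
    (left_unique : ∀ {a a' t b b'}, rB b b' → R a t b → R a' t b' → rA a a') :
    Nonempty (Quot rA ≃ T × Quot rB) := by
  choose ft fb hf using exists_right
  choose g hg using exists_left
  refine ⟨⟨Quot.lift (fun a => (ft a, Quot.mk rB (fb a))) fun a a' h => ?_,
    fun p => Quot.lift (fun b => Quot.mk rA (g p.1 b)) (fun b b' h => ?_) p.2, ?_, ?_⟩⟩
  · obtain ⟨h1, h2⟩ := right_unique h (hf a) (hf a')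
    exact Prod.ext h1 (Quot.sound h2)
  · exact Quot.sound (left_unique h (hg _ _) (hg _ _))
  · rintro ⟨a⟩
    exact Quot.sound (left_unique (reflB _) (hg _ _) (hf a))
  · rintro ⟨t, ⟨b⟩⟩
    obtain ⟨h1, h2⟩ := right_unique (reflA _) (hf (g t b)) (hg t b)
    exact Prod.ext h1 (Quot.sound h2)

/-! ### Opening edges into a new face -/

/-- Cycles that avoid the modified region are unchanged. -/
theorem Equiv.Perm.card_quot_sameCycle_avoiding_eq {D E : Type*} [Finite D] [Finite E]
    {σ : Equiv.Perm D} {σ' : Equiv.Perm E} {f : D → E} (hf : Function.Injective f) {A : Set D}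
    {B : Set E} (hB : ∀ y, y ∈ B ∨ ∃ x, f x = y) (hfB : ∀ x, f x ∉ B)
    (hout : ∀ x ∉ A, σ' (f x) = f (σ x)) (hin : ∀ x ∈ A, σ' (f x) ∈ B) :
    Nat.card (Quot fun a b : {x // ∀ a ∈ A, ¬ σ.SameCycle a x} => σ.SameCycle a b) =
      Nat.card (Quot fun a b : {y // ∀ b ∈ B, ¬ σ'.SameCycle b y} => σ'.SameCycle a b) := by
  have hpow : ∀ x, (∀ a ∈ A, ¬ σ.SameCycle a x) → ∀ n : ℕ, (σ' ^ n) (f x) = f ((σ ^ n) x) := by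
    intro x hx n
    induction n with
    | zero => rfl
    | succ n ih =>
      rw [pow_succ', pow_succ', Perm.mul_apply, Perm.mul_apply, ih, hout]
      exact fun h => hx _ h (sameCycle_pow_left.2 (SameCycle.refl _ _))
  have hpow' : ∀ x, (∀ b ∈ B, ¬ σ'.SameCycle b (f x)) → ∀ n : ℕ,
      (σ ^ n) x ∉ A ∧ (σ' ^ n) (f x) = f ((σ ^ n) x) := by
    intro x hx n
    induction n with
    | zero =>
      refine ⟨fun h => hx _ (hin x h) (sameCycle_apply_left.2 (SameCycle.refl _ _)), rfl⟩
    | succ n ih =>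
      have h1 : (σ' ^ (n + 1)) (f x) = f ((σ ^ (n + 1)) x) := by
        rw [pow_succ', pow_succ', Perm.mul_apply, Perm.mul_apply, ih.2, hout _ ih.1]
      refine ⟨fun h => hx _ (hin _ h) ?_, h1⟩
      rw [← h1]
      exact sameCycle_apply_left.2 (sameCycle_pow_left.2 (SameCycle.refl _ _))
  have hiff : ∀ x, (∀ a ∈ A, ¬ σ.SameCycle a x) → ∀ y,
      σ.SameCycle x y ↔ σ'.SameCycle (f x) (f y) := by
    intro x hx y
    constructor
    · intro h
      obtain ⟨n, rfl⟩ := h.exists_nat_pow_eq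
      rw [← hpow x hx]
      exact sameCycle_pow_right.2 (SameCycle.refl _ _)
    · intro h
      obtain ⟨n, hn⟩ := h.exists_nat_pow_eq
      rw [hpow x hx] at hn
      rw [← hf hn]
      exact sameCycle_pow_right.2 (SameCycle.refl _ _)
  have hmaps : ∀ x, (∀ a ∈ A, ¬ σ.SameCycle a x) → ∀ b ∈ B, ¬ σ'.SameCycle b (f x) := by
    intro x hx b hb h
    obtain ⟨n, hn⟩ := h.symm.exists_nat_pow_eq
    rw [hpow x hx] at hn
    exact hfB _ (hn ▸ hb)
  refine Nat.card_congr (Quot.congr (Equiv.ofBijective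
    (fun x => ⟨f x.1, hmaps x.1 x.2⟩ : {x // ∀ a ∈ A, ¬ σ.SameCycle a x} →
      {y // ∀ b ∈ B, ¬ σ'.SameCycle b y}) ⟨?_, ?_⟩) fun x y => hiff x.1 x.2 y.1)
  · exact fun x y h => Subtype.ext (hf (congrArg Subtype.val h))
  · rintro ⟨y, hy⟩
    obtain h | ⟨x, rfl⟩ := hB y
    · exact absurd (SameCycle.refl _ _) (hy y h)
    · refine ⟨⟨x, fun a ha h => ?_⟩, rfl⟩
      obtain ⟨n, hn⟩ := h.symm.exists_nat_pow_eq
      exact (hpow' x hy n).1 (hn ▸ ha)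

theorem Equiv.mem_range_inr_or_exists_inl {D E ι : Type*} (h : D ⊕ ι ≃ E) (y : E) :
    y ∈ Set.range (fun i => h (.inr i)) ∨ ∃ x, h (.inl x) = y := by
  obtain ⟨x | i, rfl⟩ := h.surjective y
  · exact .inr ⟨x, rfl⟩
  · exact .inl ⟨i, rfl⟩

theorem Equiv.inl_notMem_range_inr {D E ι : Type*} (h : D ⊕ ι ≃ E) (x : D) :
    h (.inl x) ∉ Set.range (fun i => h (.inr i)) := by
  rintro ⟨i, hi⟩
  simp at hi

/-- `Unzips φ α φ' α' t s h`: the map with face permutation `φ'` and edge involution `α'` is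
obtained from the one given by `φ` and `α` by opening the edges with darts `s 0, s 1, …` into a
new face, whose darts are indexed clockwise by `Fin N`; the involution `t` records how the sides
of the new face were glued. -/
structure Unzips {D E : Type*} {N : ℕ} [NeZero N] (φ α : Equiv.Perm D) (φ' α' : Equiv.Perm E)
    (t : Equiv.Perm (Fin N)) (s : Fin N → D) (h : D ⊕ Fin N ≃ E) : Prop where
  injective : Function.Injective s
  phi_inl : ∀ d, φ' (h (.inl d)) = h (.inl (φ d))
  phi_inr : ∀ i, φ' (h (.inr (i + 1))) = h (.inr i)
  alpha_of_notMem : ∀ d ∉ Set.range s, α' (h (.inl d)) = h (.inl (α d))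
  alpha_inl : ∀ i, α' (h (.inl (s i))) = h (.inr i)
  alpha_inr : ∀ i, α' (h (.inr i)) = h (.inl (s i))
  alpha_apply : ∀ i, α (s i) = s (t i)
  involutive : ∀ i, t (t i) = i

namespace Unzips

variable {D E : Type*} {N : ℕ} [NeZero N] {φ α : Equiv.Perm D} {φ' α' : Equiv.Perm E}
  {t : Equiv.Perm (Fin N)} {s : Fin N → D} {h : D ⊕ Fin N ≃ E}

theorem sigma_of_notMem (u : Unzips φ α φ' α' t s h) {d : D} (hd : d ∉ Set.range s) :
    (φ' * α') (h (.inl d)) = h (.inl ((φ * α) d)) := by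
  simp [u.alpha_of_notMem d hd, u.phi_inl]

theorem sigma_inl (u : Unzips φ α φ' α' t s h) (i : Fin N) :
    (φ' * α') (h (.inl (s (i + 1)))) = h (.inr i) := by
  simp [u.alpha_inl, u.phi_inr]

theorem sigma_inr (u : Unzips φ α φ' α' t s h) (i : Fin N) :
    (φ' * α') (h (.inr (t i))) = h (.inl ((φ * α) (s i))) := by
  simp [u.alpha_inr, u.phi_inl, u.alpha_apply]

theorem firstHit_inl (u : Unzips φ α φ' α' t s h) {x y : D} {k : Fin N}
    (hxy : FirstHit (φ * α) (Set.range s) x y) (hy : y = s (k + 1)) :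
    FirstHit (φ' * α') (Set.range fun i => h (.inr i)) (h (.inl x)) (h (.inr k)) := by
  induction hxy with
  | here =>
    subst hy
    refine .step (h.inl_notMem_range_inr _) ?_
    rw [u.sigma_inl]
    exact .here ⟨k, rfl⟩
  | step hn _ ih =>
    refine .step (h.inl_notMem_range_inr _) ?_
    rw [u.sigma_of_notMem hn]
    exact ih hy

/-- The new face is simple if and only if `s` follows the contour of the opened submap. -/
theorem simple_iff [Finite D] [Finite E] (u : Unzips φ α φ' α' t s h) :
    (∀ i j, (φ' * α').SameCycle (h (.inr i)) (h (.inr j)) → i = j) ↔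
      ∀ i, FirstHit (φ * α) (Set.range s) ((φ * α) (s i)) (s (t i + 1)) := by
  constructor
  · intro hs i
    obtain ⟨y, hy⟩ := FirstHit.exists_of_mem (σ := φ * α) (S := Set.range s) ⟨i, rfl⟩
    obtain ⟨j, rfl⟩ := hy.mem
    have hj := u.firstHit_inl (k := j - 1) hy (by simp)
    rw [← u.sigma_inr] at hj
    have := hs _ _ (sameCycle_apply_left.1 hj.sameCycle)
    rw [this]
    simpa using hy
  · intro hc i j hij
    have hfh : ∀ i, FirstHit (φ' * α') (Set.range fun i => h (.inr i))
        ((φ' * α') (h (.inr i))) (h (.inr ((1 : Equiv.Perm (Fin N)) i))) := by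
      intro i
      have := u.firstHit_inl (hc (t i)) rfl
      rwa [← u.sigma_inr, u.involutive] at this
    have hinj : Function.Injective fun i => h (.inr i) := fun i j hij => by simpa using hij
    exact sameCycle_one.1 ((sameCycle_iff_of_firstHit hinj hfh i j).1 hij)

theorem card_faces [Finite D] [Finite E] (u : Unzips φ α φ' α' t s h) :
    Nat.card (Quot φ'.SameCycle) = Nat.card (Quot φ.SameCycle) + 1 := by
  have hinl : Function.Injective fun d => h (.inl d) := fun i j hij => by simpa using hij
  rw [Nat.card_quot_eq_add (SameCycle.equivalence φ') (Set.range fun i => h (.inr i)),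
    Nat.card_quot_eq_add (SameCycle.equivalence φ) ∅,
    card_quot_sameCycle_avoiding_eq (A := ∅) hinl h.mem_range_inr_or_exists_inl
      h.inl_notMem_range_inr (fun x _ => u.phi_inl x) (fun x hx => hx.elim)]
  have h0 : Nat.card (Quot fun a b : (∅ : Set D) => φ.SameCycle a b) = 0 := by
    have : IsEmpty (Quot fun a b : (∅ : Set D) => φ.SameCycle a b) := by
      constructor
      rintro ⟨⟨x, hx⟩⟩
      exact hx
    exact Nat.card_of_isEmpty
  have hcyc : ∀ i, φ'.SameCycle (h (.inr 0)) (h (.inr i)) := by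
    intro i
    induction i using Fin.cyclic_induction with
    | h0 => exact SameCycle.refl _ _
    | hs i ih => exact sameCycle_apply_right.1 ((u.phi_inr i).symm ▸ ih)
  have h1 : Nat.card (Quot fun a b : (Set.range fun i => h (.inr i)) => φ'.SameCycle a b) = 1 := by
    rw [Nat.card_eq_one_iff_unique]
    refine ⟨⟨?_⟩, ⟨Quot.mk _ ⟨_, 0, rfl⟩⟩⟩
    rintro ⟨⟨_, i, rfl⟩⟩ ⟨⟨_, j, rfl⟩⟩
    exact Quot.sound ((hcyc i).symm.trans (hcyc j))
  rw [h0, h1]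
  omega

theorem card_quot_range [Finite D]
    (u : Unzips φ α φ' α' t s h)
    (hc : ∀ i, FirstHit (φ * α) (Set.range s) ((φ * α) (s i)) (s (t i + 1))) :
    Nat.card (Quot fun a b : Set.range s => (φ * α).SameCycle a b) =
      Nat.card (Quot (Equiv.addRight 1 * t).SameCycle) :=
  (Nat.card_congr (Quot.congr (Equiv.ofInjective s u.injective) fun i j =>
    (sameCycle_iff_of_firstHit (π := Equiv.addRight 1 * t) u.injective hc i j).symm)).symm

theorem card_vertices [Finite D] [Finite E] (u : Unzips φ α φ' α' t s h)
    (hc : ∀ i, FirstHit (φ * α) (Set.range s) ((φ * α) (s i)) (s (t i + 1))) :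
    Nat.card (Quot (φ' * α').SameCycle) + Nat.card (Quot (Equiv.addRight 1 * t).SameCycle) =
      Nat.card (Quot (φ * α).SameCycle) + N := by
  have hinl : Function.Injective fun d => h (.inl d) := fun i j hij => by simpa using hij
  have hinr : Function.Injective fun i => h (.inr i) := fun i j hij => by simpa using hij
  have hin : ∀ x ∈ Set.range s, (φ' * α') (h (.inl x)) ∈ Set.range fun i => h (.inr i) := by
    rintro _ ⟨i, rfl⟩
    refine ⟨i - 1, ?_⟩
    have := u.sigma_inl (i - 1)
    rw [sub_add_cancel] at this
    exact this.symm
  rw [Nat.card_quot_eq_add (SameCycle.equivalence (φ' * α')) (Set.range fun i => h (.inr i)),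
    Nat.card_quot_eq_add (SameCycle.equivalence (φ * α)) (Set.range s),
    card_quot_sameCycle_avoiding_eq hinl h.mem_range_inr_or_exists_inl h.inl_notMem_range_inr
      (fun x hx => u.sigma_of_notMem hx) hin, u.card_quot_range hc]
  have hB : Nat.card (Quot fun a b : (Set.range fun i => h (.inr i)) =>
      (φ' * α').SameCycle a b) = N := by
    have e : Fin N ≃ Quot fun a b : (Set.range fun i => h (.inr i)) =>
        (φ' * α').SameCycle a b := by
      refine Equiv.ofBijective (fun i => Quot.mk _ ⟨_, i, rfl⟩) ⟨fun i j hij => ?_, ?_⟩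
      · have hr : Equivalence fun a b : (Set.range fun i => h (.inr i)) =>
            (φ' * α').SameCycle a b :=
          (SameCycle.equivalence (φ' * α')).comap _
        exact u.simple_iff.2 hc i j (hr.eqvGen_iff.1 (Quot.eqvGen_exact hij))
      · rintro ⟨⟨_, i, rfl⟩⟩
        exact ⟨i, rfl⟩
    rw [← Nat.card_congr e, Nat.card_fin]
  rw [hB]
  omega

end Unzips

/-- The group generated by `φ` and `α` is transitive, in terms of invariant sets. -/
def JointlyTransitive {D : Type*} (φ α : Equiv.Perm D) : Prop :=
  ∀ X : Set D, X.Nonempty → (∀ x ∈ X, φ x ∈ X) → (∀ x ∈ X, α x ∈ X) → ∀ x, x ∈ X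

namespace Unzips

variable {D E : Type*} {N : ℕ} [NeZero N] {φ α : Equiv.Perm D} {φ' α' : Equiv.Perm E}
  {t : Equiv.Perm (Fin N)} {s : Fin N → D} {h : D ⊕ Fin N ≃ E}

theorem jointlyTransitive_unzip (u : Unzips φ α φ' α' t s h)
    (hD : JointlyTransitive φ α) : JointlyTransitive φ' α' := by
  intro X hX hφ hα
  obtain ⟨d, hd⟩ : ∃ d, h (.inl d) ∈ X := by
    obtain ⟨y, hy⟩ := hX
    obtain ⟨d | i, rfl⟩ := h.surjective y
    · exact ⟨d, hy⟩
    · exact ⟨s i, u.alpha_inr i ▸ hα _ hy⟩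
  have hinr : ∀ i, h (.inr i) ∈ X → ∀ j, h (.inr j) ∈ X := by
    intro i hi j
    have := Fin.cyclic_induction_from (p := fun k => h (.inr (-k)) ∈ X) (-i) (by simpa using hi)
      (fun k hk => by
        have h2 := u.phi_inr (-(k + 1))
        rw [neg_add, neg_add_cancel_right] at h2
        have h3 := hφ _ hk
        rw [h2] at h3
        rwa [neg_add]) (-j)
    simpa using this
  have hDX : ∀ d, h (.inl d) ∈ X := by
    refine hD {d | h (.inl d) ∈ X} ⟨d, hd⟩ (fun x hx => ?_) fun x hx => ?_
    · have := hφ _ hx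
      rwa [u.phi_inl] at this
    by_cases hxs : x ∈ Set.range s
    · obtain ⟨i, rfl⟩ := hxs
      have hi : h (.inr i) ∈ X := u.alpha_inl i ▸ hα _ hx
      have := hα _ (hinr i hi (t i))
      rwa [u.alpha_inr, ← u.alpha_apply] at this
    · have := hα _ hx
      rwa [u.alpha_of_notMem x hxs] at this
  intro y
  obtain ⟨x | i, rfl⟩ := h.surjective y
  · exact hDX x
  · exact u.alpha_inl i ▸ hα _ (hDX (s i))

theorem jointlyTransitive_zip (u : Unzips φ α φ' α' t s h)
    (hc : ∀ i, FirstHit (φ * α) (Set.range s) ((φ * α) (s i)) (s (t i + 1)))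
    (hE : JointlyTransitive φ' α') : JointlyTransitive φ α := by
  intro X hX hφ hα
  have hσ : ∀ x ∈ X, (φ * α) x ∈ X := fun x hx => hφ _ (hα _ hx)
  by_cases hXs : ∃ i, s i ∈ X
  · obtain ⟨i, hi⟩ := hXs
    have hs : ∀ j, s j ∈ X := by
      refine Fin.cyclic_induction_from i hi fun k hk => ?_
      have h1 := hc (t k)
      rw [u.involutive, ← u.alpha_apply] at h1
      exact h1.mem_of_closed hσ (hσ _ (hα _ hk))
    intro x
    have := hE ((fun d => h (.inl d)) '' X ∪ Set.range fun i => h (.inr i))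
      ⟨_, .inr ⟨0, rfl⟩⟩ ?_ ?_ (h (.inl x))
    · obtain ⟨y, hy, hyx⟩ | hx := this
      · simp only [EmbeddingLike.apply_eq_iff_eq, Sum.inl.injEq] at hyx
        exact hyx ▸ hy
      · exact absurd hx (h.inl_notMem_range_inr x)
    · rintro _ (⟨y, hy, rfl⟩ | ⟨j, rfl⟩)
      · exact .inl ⟨φ y, hφ y hy, (u.phi_inl y).symm⟩
      · refine .inr ⟨j - 1, ?_⟩
        simpa using (u.phi_inr (j - 1)).symm
    · rintro _ (⟨y, hy, rfl⟩ | ⟨j, rfl⟩)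
      · by_cases hys : y ∈ Set.range s
        · obtain ⟨j, rfl⟩ := hys
          exact .inr ⟨j, (u.alpha_inl j).symm⟩
        · exact .inl ⟨α y, hα y hy, (u.alpha_of_notMem y hys).symm⟩
      · exact .inl ⟨s j, hs j, (u.alpha_inr j).symm⟩
  · push Not at hXs
    exfalso
    obtain ⟨x, hx⟩ := hX
    have := hE ((fun d => h (.inl d)) '' X) ⟨_, x, hx, rfl⟩ ?_ ?_ (h (.inr 0))
    · obtain ⟨y, -, hy⟩ := this
      simp at hy
    · rintro _ ⟨y, hy, rfl⟩
      exact ⟨φ y, hφ y hy, (u.phi_inl y).symm⟩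
    · rintro _ ⟨y, hy, rfl⟩
      refine ⟨α y, hα y hy, (u.alpha_of_notMem y ?_).symm⟩
      rintro ⟨i, rfl⟩
      exact hXs i hy

end Unzips

/-! ### The contour of a tree -/

/-- A connected graph, given by its darts, has at most one more vertex than it has edges. -/
theorem two_mul_card_le_of_dart_connected {Q D : Type*} [Finite Q] [Finite D] [Nonempty Q]
    {v w : D → Q} {β : D → D} (hv : ∀ d, v (β d) = w d) (hw : ∀ d, w (β d) = v d)
    (hconn : ∀ x y, Relation.ReflTransGen (fun x y => ∃ d, v d = x ∧ w d = y) x y) :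
    2 * Nat.card Q ≤ Nat.card D + 2 := by
  classical
  have := Fintype.ofFinite Q
  have := Fintype.ofFinite D
  let G : SimpleGraph Q :=
    { Adj := fun x y => x ≠ y ∧ ∃ d, v d = x ∧ w d = y
      symm := ⟨by
        rintro x y ⟨hne, d, rfl, rfl⟩
        exact ⟨hne.symm, β d, hv d, hw d⟩⟩
      loopless := ⟨fun x h => h.1 rfl⟩ }
  have hG : G.Connected := by
    refine ⟨fun x y => ?_⟩
    induction hconn x y with
    | refl => exact .refl _
    | @tail y z _ h ih =>
      by_cases hyz : y = z
      · exact hyz ▸ ih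
      · exact ih.trans (SimpleGraph.Adj.reachable (G := G) ⟨hyz, h⟩)
  have h1 := hG.card_vert_le_card_edgeSet_add_one
  have h2 := G.dart_card_eq_twice_card_edges
  have h3 : Fintype.card G.Dart ≤ Fintype.card D := by
    choose f hf using fun e : G.Dart => e.adj.2
    refine Fintype.card_le_of_injective f fun e e' h => ?_
    refine SimpleGraph.Dart.ext _ _ (Prod.ext ?_ ?_)
    · rw [← (hf e).1, ← (hf e').1, h]
    · rw [← (hf e).2, ← (hf e').2, h]
  rw [Nat.card_eq_fintype_card, Nat.card_eq_fintype_card, ← SimpleGraph.edgeFinset_card] at h1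
  rw [Nat.card_eq_fintype_card, Nat.card_eq_fintype_card]
  omega

section Tree

variable {D : Type*} [Finite D] {σ α : Equiv.Perm D} {S : Finset D}

/-- Every edge of a tree separates it. -/
theorem exists_separating_set (hinv : ∀ d, α (α d) = d) (hfix : ∀ d, α d ≠ d)
    (hα : ∀ d ∈ S, α d ∈ S)
    (hconn : ∀ d ∈ S, ∀ d' ∈ S, Relation.ReflTransGen
      (fun a b => a ∈ S ∧ b ∈ S ∧ (σ.SameCycle a b ∨ b = α a)) d d')
    (hcard : Nat.card (Quot fun a b : {d // d ∈ S} => σ.SameCycle a.1 b.1) = S.card / 2 + 1)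
    {d : D} (hd : d ∈ S) :
    ∃ X : Set D, α d ∈ X ∧ d ∉ X ∧ (∀ x ∈ X, ∀ y ∈ S, σ.SameCycle x y → y ∈ X) ∧
      (∀ x ∈ X, x ∈ S) ∧ ∀ x ∈ X, x ≠ α d → α x ∈ X := by
  classical
  let r : D → D → Prop := fun a b =>
    a ∈ S ∧ b ∈ S ∧ (σ.SameCycle a b ∨ b = α a ∧ a ≠ d ∧ a ≠ α d)
  have hS : ∀ {x}, Relation.ReflTransGen r (α d) x → x ∈ S := by
    intro x hx
    induction hx with
    | refl => exact hα d hd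
    | tail _ h _ => exact h.2.1
  have hdX : ¬ Relation.ReflTransGen r (α d) d := by
    intro hcontra
    let Q := Quot fun a b : {d // d ∈ S} => σ.SameCycle a.1 b.1
    let mk : ∀ a, a ∈ S → Q := fun a ha => Quot.mk _ ⟨a, ha⟩
    let D' := {x // x ∈ S ∧ x ≠ d ∧ x ≠ α d}
    let v : D' → Q := fun x => mk x.1 x.2.1
    let w : D' → Q := fun x => mk (α x.1) (hα _ x.2.1)
    let β : D' → D' := fun x => ⟨α x.1, hα _ x.2.1,
      fun h => x.2.2.2 ((hinv _).symm.trans (congrArg α h)), fun h => x.2.2.1 (α.injective h)⟩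
    have hv : ∀ x, v (β x) = w x := fun x => rfl
    have hw : ∀ x, w (β x) = v x := fun x => by
      simp only [w, v, β, hinv]
    let e : Q → Q → Prop := Relation.ReflTransGen fun x y => ∃ d, v d = x ∧ w d = y
    have he_symm : ∀ {x y}, e x y → e y x := by
      intro x y h
      induction h with
      | refl => exact .refl
      | tail _ h ih =>
        obtain ⟨d, rfl, rfl⟩ := h
        exact .head ⟨β d, hv d, hw d⟩ ih
    have hr : ∀ a b, Relation.ReflTransGen r a b → ∀ (ha : a ∈ S) (hb : b ∈ S),
        e (mk a ha) (mk b hb) := by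
      intro a b h ha
      induction h with
      | refl => exact fun _ => .refl
      | @tail b c _ h ih =>
        intro hc
        obtain ⟨hb, -, h | ⟨rfl, h1, h2⟩⟩ := h
        · have : mk b hb = mk c hc := Quot.sound h
          exact this ▸ ih hb
        · exact .tail (ih hb) ⟨⟨b, hb, h1, h2⟩, rfl, rfl⟩
    have hbr := hr _ _ hcontra (hα d hd) hd
    have hall : ∀ a b, Relation.ReflTransGen
        (fun a b => a ∈ S ∧ b ∈ S ∧ (σ.SameCycle a b ∨ b = α a)) a b →
        ∀ (ha : a ∈ S) (hb : b ∈ S), e (mk a ha) (mk b hb) := by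
      intro a b h ha
      induction h with
      | refl => exact fun _ => .refl
      | @tail b c _ h ih =>
        intro hc
        obtain ⟨hb, -, h | rfl⟩ := h
        · have : mk b hb = mk c hc := Quot.sound h
          exact this ▸ ih hb
        · by_cases h1 : b = d
          · subst h1
            exact (ih hb).trans (he_symm hbr)
          by_cases h2 : b = α d
          · subst h2
            have : mk (α (α d)) hc = mk d hd := by simp only [hinv]
            exact (ih hb).trans (this ▸ hbr)
          · exact .tail (ih hb) ⟨⟨b, hb, h1, h2⟩, rfl, rfl⟩
    have : Nonempty Q := ⟨mk d hd⟩
    have hle := two_mul_card_le_of_dart_connected hv hw (by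
      rintro ⟨a, ha⟩ ⟨b, hb⟩
      exact hall a b (hconn a ha b hb) ha hb)
    have hD' : Nat.card D' = S.card - 2 := by
      have h1 : Nat.card D' = ((S.erase d).erase (α d)).card :=
        Nat.subtype_card _ fun x => by simp only [Finset.mem_erase]; tauto
      rw [h1, Finset.card_erase_of_mem (by simp [hfix, hα d hd]), Finset.card_erase_of_mem hd]
      omega
    have h2 : 2 ≤ S.card := by
      have := Finset.card_le_card (s := {d, α d}) (t := S) (by
        intro x hx
        simp only [Finset.mem_insert, Finset.mem_singleton] at hx
        obtain rfl | rfl := hx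
        exacts [hd, hα _ hd])
      rwa [Finset.card_pair (hfix d).symm] at this
    have hQ : Nat.card Q = S.card / 2 + 1 := hcard
    omega
  refine ⟨{x | Relation.ReflTransGen r (α d) x}, .refl, hdX, ?_, fun x hx => hS hx, ?_⟩
  · exact fun x hx y hy h => .tail hx ⟨hS hx, hy, .inl h⟩
  · exact fun x hx h => .tail hx ⟨hS hx, hα _ (hS hx), .inr
      ⟨rfl, fun h => hdX (by subst h; exact hx), h⟩⟩

/-- The contour of a plane tree is a single cycle. -/
theorem sameCycle_contour (hinv : ∀ d, α (α d) = d) (hfix : ∀ d, α d ≠ d)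
    (hα : ∀ d ∈ S, α d ∈ S)
    (hconn : ∀ d ∈ S, ∀ d' ∈ S, Relation.ReflTransGen
      (fun a b => a ∈ S ∧ b ∈ S ∧ (σ.SameCycle a b ∨ b = α a)) d d')
    (hcard : Nat.card (Quot fun a b : {d // d ∈ S} => σ.SameCycle a.1 b.1) = S.card / 2 + 1)
    {c : Equiv.Perm {d // d ∈ S}} (hc : ∀ d, FirstHit σ {d | d ∈ S} (σ (α d.1)) (c d).1)
    (d d' : {d // d ∈ S}) : c.SameCycle d d' := by
  have hαc : ∀ x, c.SameCycle x ⟨α x.1, hα _ x.2⟩ := by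
    intro x
    by_contra hx
    obtain ⟨X, h1, h2, h3, h4, h5⟩ := exists_separating_set hinv hfix hα hconn hcard x.2
    have hsc : ∀ y : {d // d ∈ S}, α y.1 ∈ X → (c y).1 ∈ X := fun y hy =>
      h3 _ hy _ (c y).2 (sameCycle_apply_left.1 (hc y).sameCycle)
    have hpow : ∀ n : ℕ, ((c ^ (n + 1)) x).1 ∈ X := by
      intro n
      induction n with
      | zero => exact hsc x h1
      | succ n ih =>
        rw [pow_succ', Equiv.Perm.mul_apply]
        refine hsc _ (h5 _ ih fun h => hx ?_)
        have : (⟨α x.1, hα _ x.2⟩ : {d // d ∈ S}) = (c ^ (n + 1)) x := Subtype.ext h.symm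
        rw [this]
        exact sameCycle_pow_right.2 (SameCycle.refl _ _)
    obtain ⟨n, hn, -, hnx⟩ := (SameCycle.refl c x).exists_pow_eq''
    obtain ⟨k, rfl⟩ := Nat.exists_eq_add_of_lt hn
    have := hpow k
    rw [zero_add] at hnx
    rw [hnx] at this
    exact h2 this
  obtain ⟨ρ, hρ⟩ := exists_firstReturn σ {d | d ∈ S}
  have hρc : ∀ x, ρ x = c ⟨α x.1, hα _ x.2⟩ := fun x => by
    refine Subtype.ext ((hρ x).unique ?_)
    have := hc ⟨α x.1, hα _ x.2⟩
    simpa only [hinv] using this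
  have hσc : ∀ x y : {d // d ∈ S}, σ.SameCycle x.1 y.1 → c.SameCycle x y := by
    intro x y hxy
    have hρ' : ∀ i : {d // d ∈ S}, FirstHit σ (Set.range fun a : {d // d ∈ S} => a.1)
        (σ i.1) (ρ i).1 := by
      have : (Set.range fun a : {d // d ∈ S} => a.1) = {d | d ∈ S} := Subtype.range_coe
      rw [this]
      exact hρ
    have := (sameCycle_iff_of_firstHit (s := fun a : {d // d ∈ S} => a.1) (π := ρ)
      Subtype.val_injective hρ' x y).1 hxy
    obtain ⟨n, rfl⟩ := this.exists_nat_pow_eq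
    clear this hxy
    induction n with
    | zero => exact SameCycle.refl _ _
    | succ n ih =>
      rw [pow_succ', Equiv.Perm.mul_apply, hρc]
      exact sameCycle_apply_right.2 (ih.trans (hαc _))
  have key : ∀ a b, Relation.ReflTransGen
      (fun a b => a ∈ S ∧ b ∈ S ∧ (σ.SameCycle a b ∨ b = α a)) a b →
      ∀ (ha : a ∈ S) (hb : b ∈ S), c.SameCycle ⟨a, ha⟩ ⟨b, hb⟩ := by
    intro a b h ha
    induction h with
    | refl => exact fun _ => SameCycle.refl _ _
    | tail _ h ih =>
      intro hb
      obtain ⟨hb', -, h | rfl⟩ := h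
      · exact (ih hb').trans (hσc ⟨_, hb'⟩ ⟨_, hb⟩ h)
      · exact (ih hb').trans (hαc _)
  exact key _ _ (hconn _ d.2 _ d'.2) d.2 d'.2

end Tree

/-! ### Plane trees and noncrossing matchings -/

theorem PlaneTree.edges_nil : (PlaneTree.node []).edges = 0 := by
  simp [PlaneTree.edges]

theorem PlaneTree.edges_cons (t : PlaneTree) (ts : List PlaneTree) :
    (PlaneTree.node (t :: ts)).edges = t.edges + 1 + (PlaneTree.node ts).edges := by
  rw [PlaneTree.edges, PlaneTree.edges, List.attach_cons, List.foldr_cons, List.foldr_map]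

/-- The inverse of the left-child right-sibling encoding of plane trees. -/
def PlaneTree.ofBinaryTree : BinaryTree Unit → PlaneTree
  | .nil => .node []
  | .node _ l r => match ofBinaryTree r with
    | .node ts => .node (ofBinaryTree l :: ts)

theorem PlaneTree.edges_ofBinaryTree (b : BinaryTree Unit) :
    (ofBinaryTree b).edges = b.numNodes := by
  induction b with
  | nil => exact edges_nil
  | node _ l r ihl ihr =>
    rw [ofBinaryTree, BinaryTree.numNodes]
    cases h : ofBinaryTree r with
    | node ts =>
      simp only
      rw [edges_cons, ihl, ← h, ihr]
      omega

theorem PlaneTree.ofBinaryTree_injective : Function.Injective ofBinaryTree := by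
  intro b
  induction b with
  | nil =>
    rintro (_ | ⟨_, l, r⟩) h
    · rfl
    · rw [ofBinaryTree, ofBinaryTree] at h
      cases h' : ofBinaryTree r with
      | node ts => simp [h'] at h
  | node _ l r ihl ihr =>
    rintro (_ | ⟨_, l', r'⟩) h
    · rw [ofBinaryTree, ofBinaryTree] at h
      cases h' : ofBinaryTree r with
      | node ts => simp [h'] at h
    · rw [ofBinaryTree, ofBinaryTree] at h
      cases h1 : ofBinaryTree r with
      | node ts =>
        cases h2 : ofBinaryTree r' with
        | node ts' =>
          simp only [h1, h2, PlaneTree.node.injEq, List.cons.injEq] at h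
          rw [ihl h.1, ihr (h1.trans (h.2 ▸ h2.symm))]

theorem PlaneTree.ofBinaryTree_surjective : Function.Surjective ofBinaryTree := by
  suffices ∀ n (t : PlaneTree), t.edges = n → ∃ b, ofBinaryTree b = t from fun t => this _ t rfl
  intro n
  induction n using Nat.strong_induction_on with
  | _ n ih =>
    rintro ⟨_ | ⟨t, ts⟩⟩ h
    · exact ⟨.nil, rfl⟩
    · rw [edges_cons] at h
      obtain ⟨l, hl⟩ := ih _ (by omega) t rfl
      obtain ⟨r, hr⟩ := ih _ (by omega) (.node ts) rfl
      exact ⟨.node () l r, by rw [ofBinaryTree, hr, hl]⟩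

/-- `f` restricts to a noncrossing perfect matching of `{0, …, L - 1}`. -/
def IsNoncrossingMatching (L : ℕ) (f : ℕ → ℕ) : Prop :=
  ∀ i < L, f i < L ∧ f (f i) = i ∧ f i ≠ i ∧ ∀ j, i < j → j < f i → i < f j ∧ f j < f i

/-- The matching of the two sides of each edge in the contour of a tree. -/
def BinaryTree.matching : BinaryTree Unit → ℕ → ℕ
  | .nil, i => i
  | .node _ l r, i =>
    if i = 0 then 2 * l.numNodes + 1
    else if i ≤ 2 * l.numNodes then matching l (i - 1) + 1
    else if i = 2 * l.numNodes + 1 then 0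
    else matching r (i - (2 * l.numNodes + 2)) + (2 * l.numNodes + 2)

theorem BinaryTree.isNoncrossingMatching_matching (b : BinaryTree Unit) :
    IsNoncrossingMatching (2 * b.numNodes) b.matching := by
  induction b with
  | nil => exact fun i hi => absurd hi (by simp [BinaryTree.numNodes])
  | node _ l r ihl ihr =>
    set k := 2 * l.numNodes with hk
    have h0 : ∀ i, i = 0 → (BinaryTree.node () l r).matching i = k + 1 := by
      intro i hi; simp [BinaryTree.matching, hi, hk]
    have h1 : ∀ i, 0 < i → i ≤ k →
        (BinaryTree.node () l r).matching i = l.matching (i - 1) + 1 := by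
      intro i hi hi'
      rw [BinaryTree.matching, if_neg (by omega), if_pos (by omega)]
    have h2 : ∀ i, i = k + 1 → (BinaryTree.node () l r).matching i = 0 := by
      intro i hi
      rw [BinaryTree.matching, if_neg (by omega), if_neg (by omega), if_pos (by omega)]
    have h3 : ∀ i, k + 2 ≤ i →
        (BinaryTree.node () l r).matching i = r.matching (i - (k + 2)) + (k + 2) := by
      intro i hi
      rw [BinaryTree.matching, if_neg (by omega), if_neg (by omega), if_neg (by omega)]
    have hn : 2 * (BinaryTree.node () l r).numNodes = k + 2 + 2 * r.numNodes := by
      rw [BinaryTree.numNodes]; omega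
    intro i hi
    change i < 2 * (BinaryTree.node () l r).numNodes at hi
    change (BinaryTree.node () l r).matching i < 2 * (BinaryTree.node () l r).numNodes ∧
      (BinaryTree.node () l r).matching ((BinaryTree.node () l r).matching i) = i ∧ _
    rw [hn] at hi ⊢
    generalize (BinaryTree.node () l r).matching = f at *
    rcases Nat.eq_zero_or_pos i with h | hpos
    · rw [h0 i h]
      refine ⟨by omega, by rw [h2 _ rfl, h], by omega, fun j hj hj' => ?_⟩
      rw [h1 j (by omega) (by omega)]
      have := (ihl (j - 1) (by omega)).1
      omega
    rcases Nat.lt_or_ge k i with h | hik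
    · rcases Nat.eq_or_lt_of_le (show k + 1 ≤ i from h) with h | h
      · rw [h2 i h.symm, h0 0 rfl]
        exact ⟨by omega, by omega, by omega, fun j _ _ => by omega⟩
      · obtain ⟨a1, a2, a3, a4⟩ := ihr (i - (k + 2)) (by omega)
        rw [h3 i h, h3 _ (by omega), Nat.add_sub_cancel, a2]
        refine ⟨by omega, by omega, by omega, fun j hj hj' => ?_⟩
        rw [h3 j (by omega)]
        have := a4 (j - (k + 2)) (by omega) (by omega)
        omega
    · obtain ⟨a1, a2, a3, a4⟩ := ihl (i - 1) (by omega)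
      rw [h1 i hpos hik, h1 _ (by omega) (by omega), Nat.add_sub_cancel, a2]
      refine ⟨by omega, by omega, by omega, fun j hj hj' => ?_⟩
      rw [h1 j (by omega) (by omega)]
      have := a4 (j - 1) (by omega) (by omega)
      omega

theorem BinaryTree.eq_of_matching_eq (b : BinaryTree Unit) : ∀ b' : BinaryTree Unit,
    b.numNodes = b'.numNodes → (∀ i < 2 * b.numNodes, b.matching i = b'.matching i) → b = b' := by
  induction b with
  | nil =>
    rintro (_ | ⟨_, l', r'⟩) hn h
    · rfl
    · simp [BinaryTree.numNodes] at hn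
  | node _ l r ihl ihr =>
    rintro (_ | ⟨_, l', r'⟩) hn h
    · simp [BinaryTree.numNodes] at hn
    · simp only [BinaryTree.numNodes] at hn h
      have hl : l.numNodes = l'.numNodes := by
        have := h 0 (by omega)
        simp only [BinaryTree.matching, if_true] at this
        omega
      have hr : r.numNodes = r'.numNodes := by omega
      rw [ihl l' hl, ihr r' hr]
      · intro i hi
        have := h (i + (2 * l.numNodes + 2)) (by omega)
        simpa [BinaryTree.matching, ← hl, show ¬ i + (2 * l.numNodes + 2) ≤ 2 * l.numNodes by omega,
          show ¬ i + (2 * l.numNodes + 2) = 2 * l.numNodes + 1 by omega] using this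
      · intro i hi
        have := h (i + 1) (by omega)
        simpa [BinaryTree.matching, ← hl, show i + 1 ≤ 2 * l.numNodes by omega] using this

theorem IsNoncrossingMatching.exists_binaryTree (L : ℕ) : ∀ f, IsNoncrossingMatching L f →
    ∃ b : BinaryTree Unit, 2 * b.numNodes = L ∧ ∀ i < L, b.matching i = f i := by
  induction L using Nat.strong_induction_on with
  | _ L ih =>
    intro f hf
    rcases Nat.eq_zero_or_pos L with rfl | hL
    · exact ⟨.nil, rfl, fun i hi => absurd hi (by omega)⟩
    obtain ⟨k, hk⟩ : ∃ k, f 0 = k + 1 := Nat.exists_eq_succ_of_ne_zero (hf 0 hL).2.2.1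
    obtain ⟨b1, b2, -, b4⟩ := hf 0 hL
    rw [hk] at b1 b2 b4
    have hout : ∀ i, k + 2 ≤ i → i < L → k + 2 ≤ f i := by
      intro i hi hiL
      obtain ⟨-, c2, -, -⟩ := hf i hiL
      by_contra hlt
      have h1 : f i ≠ 0 := fun h => by rw [h] at c2; omega
      have h2 : f i ≠ k + 1 := fun h => by rw [h] at c2; omega
      have := b4 (f i) (by omega) (by omega)
      omega
    obtain ⟨l, hl, hl'⟩ := ih k (by omega) (fun i => f (i + 1) - 1) (by
      intro i hi
      have c := b4 (i + 1) (by omega) (by omega)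
      obtain ⟨a1, a2, a3, a4⟩ := hf (i + 1) (by omega)
      simp only
      rw [Nat.sub_add_cancel (by omega), a2]
      refine ⟨by omega, by omega, by omega, fun j hj hj' => ?_⟩
      have := a4 (j + 1) (by omega) (by omega)
      omega)
    obtain ⟨r, hr, hr'⟩ := ih (L - (k + 2)) (by omega) (fun i => f (i + (k + 2)) - (k + 2)) (by
      intro i hi
      have c := hout (i + (k + 2)) (by omega) (by omega)
      obtain ⟨a1, a2, a3, a4⟩ := hf (i + (k + 2)) (by omega)
      simp only
      rw [Nat.sub_add_cancel (by omega), a2]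
      refine ⟨by omega, by omega, by omega, fun j hj hj' => ?_⟩
      have := a4 (j + (k + 2)) (by omega) (by omega)
      omega)
    refine ⟨.node () l r, by rw [BinaryTree.numNodes]; omega, fun i hi => ?_⟩
    rw [BinaryTree.matching, hl]
    split_ifs with h1 h2 h3
    · rw [h1, hk]
    · have := b4 i (by omega) (by omega)
      simp only [hl' (i - 1) (by omega), Nat.sub_add_cancel (show 1 ≤ i by omega)]
      omega
    · rw [h3, b2]
    · have := hout i (by omega) hi
      simp only [hr' (i - (k + 2)) (by omega), Nat.sub_add_cancel (show k + 2 ≤ i by omega)]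
      omega

theorem two_mul_card_lt_filter {N : ℕ} {t : Equiv.Perm (Fin N)}
    (hinv : ∀ i, t (t i) = i) (hfix : ∀ i, t i ≠ i) :
    2 * (Finset.univ.filter fun i => t i < i).card = N := by
  have h1 : (Finset.univ.filter fun i => t i < i).card =
      (Finset.univ.filter fun i => ¬ t i < i).card := by
    refine Finset.card_bij (fun i _ => t i) ?_ (fun i _ j _ h => t.injective h) ?_
    · intro i hi
      simp only [Finset.mem_filter, Finset.mem_univ, true_and, hinv, not_lt] at hi ⊢
      exact hi.le
    · intro i hi
      simp only [Finset.mem_filter, Finset.mem_univ, true_and, not_lt] at hi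
      exact ⟨t i, by simpa [hinv] using lt_of_le_of_ne hi (hfix i).symm, hinv i⟩
  have h2 := Finset.card_filter_add_card_filter_not (s := (Finset.univ : Finset (Fin N)))
    (p := fun i => t i < i)
  rw [Finset.card_univ, Fintype.card_fin] at h2
  omega

section Noncrossing

variable {N : ℕ} [NeZero N] {t : Equiv.Perm (Fin N)}

theorem Fin.val_add_one_eq_of_lt {N : ℕ} [NeZero N] {i j : Fin N} (h : i < j) :
    ((i + 1 : Fin N) : ℕ) = i + 1 := by
  have hj := j.2
  have hij : (i : ℕ) < j := h
  rw [Fin.val_add, Fin.val_one', Nat.add_mod_mod, Nat.mod_eq_of_lt (by omega)]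

theorem Fin.val_add_one_eq_zero {N : ℕ} [NeZero N] {i : Fin N} (h : (i : ℕ) + 1 = N) :
    ((i + 1 : Fin N) : ℕ) = 0 := by
  rw [Fin.val_add, Fin.val_one', Nat.add_mod_mod, h, Nat.mod_self]

/-- Points where `i ↦ t i + 1` does not increase. -/
theorem add_one_le_iff (hfix : ∀ i, t i ≠ i) (i : Fin N) :
    t i + 1 ≤ i ↔ t i < i ∨ (t i : ℕ) + 1 = N := by
  rw [Fin.le_def, Fin.lt_def]
  have h0 := Fin.val_ne_of_ne (hfix i)
  have h1 := (t i).2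
  have h2 := i.2
  by_cases h : (t i : ℕ) + 1 = N
  · simp [Fin.val_add_one_eq_zero h, h]
  · have h' : t i < (⟨t i + 1, by omega⟩ : Fin N) := by simp [Fin.lt_def]
    rw [Fin.val_add_one_eq_of_lt h']
    omega

theorem card_add_one_le {m : ℕ} (hN : N = 2 * m) (hinv : ∀ i, t (t i) = i)
    (hfix : ∀ i, t i ≠ i) : Nat.card {i // t i + 1 ≤ i} = m + 1 := by
  have hpos := Nat.pos_of_ne_zero (NeZero.ne N)
  let l : Fin N := ⟨N - 1, by omega⟩
  have hl : (l : ℕ) = N - 1 := rfl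
  have hcard := two_mul_card_lt_filter hinv hfix
  rw [Nat.subtype_card (insert (t l) (Finset.univ.filter fun i => t i < i)),
    Finset.card_insert_of_notMem]
  · omega
  · simp only [Finset.mem_filter, Finset.mem_univ, true_and, hinv, Fin.lt_def, hl]
    omega
  · intro i
    rw [add_one_le_iff hfix]
    simp only [Finset.mem_insert, Finset.mem_filter, Finset.mem_univ, true_and]
    have : i = t l ↔ (t i : ℕ) + 1 = N := by
      rw [← t.injective.eq_iff, hinv, Fin.ext_iff, hl]
      omega
    rw [this, or_comm]

theorem Equiv.Perm.sameCycle_subset_of_mapsTo {X : Type*} [Finite X] {c : Equiv.Perm X}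
    {A : Set X} (hA : ∀ x ∈ A, c x ∈ A) {x y : X} (hx : x ∈ A) (h : c.SameCycle x y) : y ∈ A := by
  obtain ⟨n, rfl⟩ := h.exists_nat_pow_eq
  clear h
  induction n with
  | zero => exact hx
  | succ n ih => rw [pow_succ', Perm.mul_apply]; exact hA _ ih

theorem noncrossing_of_forall_eq (hinv : ∀ i, t (t i) = i) (hfix : ∀ i, t i ≠ i)
    (h : ∀ x y, t x + 1 ≤ x → t y + 1 ≤ y → (Equiv.addRight 1 * t).SameCycle x y → x = y)
    (n : ℕ) : ∀ i, (t i : ℕ) ≤ i + n → ∀ j, i < j → j < t i → i < t j ∧ t j < t i := by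
  classical
  induction n with
  | zero =>
    intro i hi j h1 h2
    rw [Fin.lt_def] at h1 h2
    omega
  | succ n ih =>
    intro i hi j h1 h2
    set c := Equiv.addRight 1 * t with hc
    have hcx : ∀ x, c x = t x + 1 := fun x => rfl
    have hit : i < t i := h1.trans h2
    have hdesc : t (t i) + 1 ≤ t i := by
      rw [add_one_le_iff (fun x => hfix x), hinv]
      exact .inl hit
    have hcti : c (t i) = i + 1 := by rw [hcx, hinv]
    have hi1 : ((i + 1 : Fin N) : ℕ) = i + 1 := Fin.val_add_one_eq_of_lt hit
    let C : Finset (Fin N) := Finset.univ.filter fun x => c.SameCycle (t i) x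
    have hC : ∀ x, x ∈ C ↔ c.SameCycle (t i) x := fun x => by simp [C]
    have hCne : C.Nonempty := ⟨t i, (hC _).2 (SameCycle.refl _ _)⟩
    have huniq : ∀ x ∈ C, c x ≤ x → x = t i := fun x hx hxd =>
      (h _ _ hdesc hxd ((hC _).1 hx)).symm
    have hmax : ∀ x ∈ C, x ≤ t i := by
      obtain ⟨y, hy, hymax⟩ := Finset.exists_max_image C id hCne
      have := huniq y hy (hymax _ ((hC _).2 (sameCycle_apply_right.2 ((hC _).1 hy))))
      exact fun x hx => this ▸ hymax x hx
    have hmin : ∀ x ∈ C, i + 1 ≤ x := by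
      obtain ⟨y, hy, hymin⟩ := Finset.exists_min_image C id hCne
      obtain ⟨z, rfl⟩ := c.surjective y
      have hz : z ∈ C := (hC _).2 (sameCycle_apply_right.1 ((hC _).1 hy))
      have := huniq z hz (hymin z hz)
      rw [this, hcti] at hymin
      exact fun x hx => hymin x hx
    have hne : (C.filter fun x => x ≤ j).Nonempty := by
      refine ⟨i + 1, ?_⟩
      rw [Finset.mem_filter, hC, ← hcti]
      refine ⟨sameCycle_apply_right.2 (SameCycle.refl _ _), ?_⟩
      rw [hcti, Fin.le_def, hi1]
      exact h1
    obtain ⟨x, hx, hxmax⟩ := Finset.exists_max_image _ id hne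
    rw [Finset.mem_filter] at hx
    obtain ⟨hxC, hxj⟩ := hx
    have hcxC : c x ∈ C := (hC _).2 (sameCycle_apply_right.2 ((hC _).1 hxC))
    have hxt : x ≠ t i := fun h => absurd (h ▸ hxj) (not_le.2 h2)
    have hxd : ¬ t x + 1 ≤ x := fun h => hxt (huniq x hxC h)
    have hjc : j < c x := by
      by_contra hle
      rw [not_lt] at hle
      exact hxd (hxmax _ (Finset.mem_filter.2 ⟨hcxC, hle⟩))
    have hxd' := hxd
    rw [add_one_le_iff hfix, not_or, not_lt] at hxd
    have hval : ((c x : Fin N) : ℕ) = t x + 1 := by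
      have := (t x).2
      exact Fin.val_add_one_eq_of_lt (j := ⟨t x + 1, by omega⟩) (by simp [Fin.lt_def])
    have e1 := hmax _ hcxC
    have e2 := hmin _ hxC
    rw [Fin.le_def, hval] at e1
    rw [Fin.le_def, hi1] at e2
    rw [Fin.lt_def, hval] at hjc
    rw [Fin.lt_def] at h1 h2
    rw [Fin.le_def] at hxj
    have hxtx := Fin.val_ne_of_ne (hfix x)
    have hxd1 := hxd.1
    rw [Fin.le_def] at hxd1
    rcases Nat.eq_or_lt_of_le hxj with e | hlt
    · rw [← Fin.ext e, Fin.lt_def, Fin.lt_def]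
      omega
    rcases Nat.eq_or_lt_of_le (Nat.le_of_lt_succ hjc) with e | hlt'
    · rw [Fin.ext e, hinv, Fin.lt_def, Fin.lt_def]
      omega
    · have := ih x (by omega) j hlt hlt'
      rw [Fin.lt_def, Fin.lt_def] at this
      rw [Fin.lt_def, Fin.lt_def]
      omega

theorem forall_eq_of_noncrossing (hinv : ∀ i, t (t i) = i) (hfix : ∀ i, t i ≠ i)
    (h : ∀ i j, i < j → j < t i → i < t j ∧ t j < t i) (x y : Fin N) (hx : t x + 1 ≤ x)
    (hy : t y + 1 ≤ y) (hxy : (Equiv.addRight 1 * t).SameCycle x y) : x = y := by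
  have key : ∀ x y, t x < x → (Equiv.addRight 1 * t).SameCycle x y → t x < y ∧ y ≤ x := by
    intro x y hx hxy
    refine sameCycle_subset_of_mapsTo (A := {y | t x < y ∧ y ≤ x}) ?_ ⟨hx, le_rfl⟩ hxy
    rintro z ⟨h1, h2⟩
    change t x < t z + 1 ∧ t z + 1 ≤ x
    rcases eq_or_lt_of_le h2 with rfl | h2
    · rw [Fin.lt_def, Fin.le_def, Fin.val_add_one_eq_of_lt hx]
      rw [Fin.lt_def] at hx
      omega
    · have := h (t x) z h1 (by rwa [hinv])
      rw [hinv] at this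
      rw [Fin.lt_def, Fin.le_def, Fin.val_add_one_eq_of_lt this.2]
      rw [Fin.lt_def, Fin.lt_def] at this
      omega
  have mixed : ∀ x y, t x < x → (t y : ℕ) + 1 = N →
      ¬ (Equiv.addRight 1 * t).SameCycle x y := by
    intro x y hx hy hxy
    obtain ⟨h1, h2⟩ := key x y hx hxy
    have hxN := x.2
    have hyx := Fin.val_ne_of_ne (hfix y)
    rcases eq_or_lt_of_le h2 with rfl | h2
    · rw [Fin.lt_def] at hx
      omega
    · have := h (t x) y h1 (by rwa [hinv])
      rw [hinv, Fin.lt_def, Fin.lt_def] at this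
      omega
  rw [add_one_le_iff hfix] at hx hy
  rcases hx with hx | hx <;> rcases hy with hy | hy
  · exact le_antisymm (key y x hy hxy.symm).2 (key x y hx hxy).2
  · exact absurd hxy (mixed x y hx hy)
  · exact absurd hxy.symm (mixed y x hy hx)
  · exact t.injective (Fin.ext (by omega))

/-- A matching of the sides of a `2m`-gon yields a plane tree, that is, `m + 1` vertices, if and
only if it is noncrossing. -/
theorem card_quot_eq_iff_noncrossing {m : ℕ} (hN : N = 2 * m) (hinv : ∀ i, t (t i) = i)
    (hfix : ∀ i, t i ≠ i) :
    Nat.card (Quot (Equiv.addRight 1 * t).SameCycle) = m + 1 ↔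
      ∀ i j, i < j → j < t i → i < t j ∧ t j < t i := by
  classical
  let f : {i // t i + 1 ≤ i} → Quot (Equiv.addRight 1 * t).SameCycle := fun i => Quot.mk _ i.1
  have hf : Function.Surjective f := by
    rintro ⟨x⟩
    let C : Finset (Fin N) := Finset.univ.filter fun y => (Equiv.addRight 1 * t).SameCycle x y
    have hC : ∀ y, y ∈ C ↔ (Equiv.addRight 1 * t).SameCycle x y := fun x => by simp [C]
    obtain ⟨y, hy, hymax⟩ := Finset.exists_max_image C id ⟨x, (hC _).2 (SameCycle.refl _ _)⟩
    exact ⟨⟨y, hymax _ ((hC _).2 (sameCycle_apply_right.2 ((hC _).1 hy)))⟩,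
      Quot.sound ((hC _).1 hy).symm⟩
  have hcard := card_add_one_le hN hinv hfix
  have hinj : Function.Injective f ↔ ∀ x y, t x + 1 ≤ x → t y + 1 ≤ y →
      (Equiv.addRight 1 * t).SameCycle x y → x = y := by
    constructor
    · exact fun h x y hx hy hxy => congrArg Subtype.val (@h ⟨x, hx⟩ ⟨y, hy⟩ (Quot.sound hxy))
    · exact fun h x y hxy => Subtype.ext (h _ _ x.2 y.2
        ((SameCycle.equivalence _).eqvGen_iff.1 (Quot.eqvGen_exact hxy)))
  constructor
  · intro h i
    have := hf.bijective_of_nat_card_le (by rw [hcard, h])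
    exact noncrossing_of_forall_eq hinv hfix (hinj.1 this.1) N i (by omega)
  · intro h
    rw [← Nat.card_congr (Equiv.ofBijective f
      ⟨hinj.2 (forall_eq_of_noncrossing hinv hfix h), hf⟩), hcard]

end Noncrossing

/-- Gluings of the sides of an `N`-gon into a plane tree with `m` edges. -/
def TreeMatching (N m : ℕ) [NeZero N] : Type :=
  {t : Equiv.Perm (Fin N) // (∀ i, t (t i) = i) ∧ (∀ i, t i ≠ i) ∧
    Nat.card (Quot (Equiv.addRight 1 * t).SameCycle) = m + 1}

theorem nonempty_planeTree_equiv_treeMatching {N m : ℕ} [NeZero N] (hN : N = 2 * m) :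
    Nonempty ({t : PlaneTree // t.edges = m} ≃ TreeMatching N m) := by
  have e₁ : {b : BinaryTree Unit // b.numNodes = m} ≃ {t : PlaneTree // t.edges = m} :=
    (Equiv.ofBijective _ ⟨PlaneTree.ofBinaryTree_injective,
      PlaneTree.ofBinaryTree_surjective⟩).subtypeEquiv fun b => by
        change b.numNodes = m ↔ (PlaneTree.ofBinaryTree b).edges = m
        rw [PlaneTree.edges_ofBinaryTree]
  have hmatch : ∀ b : {b : BinaryTree Unit // b.numNodes = m},
      IsNoncrossingMatching N b.1.matching := fun b => by
    have := b.1.isNoncrossingMatching_matching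
    rwa [b.2, ← hN] at this
  have hinvol : ∀ b : {b : BinaryTree Unit // b.numNodes = m}, Function.Involutive
      (fun i : Fin N => (⟨b.1.matching i, (hmatch b i i.2).1⟩ : Fin N)) :=
    fun b i => Fin.ext (hmatch b i i.2).2.1
  let g : {b : BinaryTree Unit // b.numNodes = m} → TreeMatching N m := fun b =>
    ⟨(hinvol b).toPerm, hinvol b, fun i hi => (hmatch b i i.2).2.2.1 (congrArg Fin.val hi),
      (card_quot_eq_iff_noncrossing (t := (hinvol b).toPerm) hN (hinvol b) fun i hi =>
        (hmatch b i i.2).2.2.1 (congrArg Fin.val hi)).2 fun i j => (hmatch b i i.2).2.2.2 j⟩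
  refine ⟨e₁.symm.trans (Equiv.ofBijective g ⟨?_, ?_⟩)⟩
  · rintro ⟨b, hb⟩ ⟨b', hb'⟩ h
    refine Subtype.ext (b.eq_of_matching_eq b' (hb.trans hb'.symm) fun i hi => ?_)
    rw [hb, ← hN] at hi
    exact congrArg Fin.val (Equiv.congr_fun (congrArg Subtype.val h) ⟨i, hi⟩)
  · rintro ⟨t, hinv, hfix, hcard⟩
    have hnc := (card_quot_eq_iff_noncrossing hN hinv hfix).1 hcard
    have hf : ∀ i (hi : i < N), (fun i => if h : i < N then (t ⟨i, h⟩ : ℕ) else 0) i =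
        t ⟨i, hi⟩ := fun i hi => dif_pos hi
    obtain ⟨b, hb, hb'⟩ := IsNoncrossingMatching.exists_binaryTree N
      (fun i => if h : i < N then (t ⟨i, h⟩ : ℕ) else 0) (by
        intro i hi
        generalize (fun i => if h : i < N then (t ⟨i, h⟩ : ℕ) else 0) = f at hf
        rw [hf i hi]
        refine ⟨(t _).2, ?_, fun h => hfix _ (Fin.ext h), fun j hj hj' => ?_⟩
        · rw [hf _ (t _).2, Fin.eta, hinv]
        · rw [hf j (hj'.trans (t _).2)]
          exact hnc ⟨i, hi⟩ ⟨j, hj'.trans (t _).2⟩ hj hj')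
    refine ⟨⟨b, by omega⟩, Subtype.ext (Equiv.ext fun i => Fin.ext ?_)⟩
    exact (hb' i i.2).trans (hf i i.2)

namespace Unzips

variable {D E D₂ E₂ : Type*} {N : ℕ} [NeZero N] {φ α : Equiv.Perm D} {φ' α' : Equiv.Perm E}
  {t : Equiv.Perm (Fin N)} {s : Fin N → D} {h : D ⊕ Fin N ≃ E}
  {φ₂ α₂ : Equiv.Perm D₂} {φ₂' α₂' : Equiv.Perm E₂}
  {t₂ : Equiv.Perm (Fin N)} {s₂ : Fin N → D₂} {h₂ : D₂ ⊕ Fin N ≃ E₂}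

theorem congr (u : Unzips φ α φ' α' t s h) (f : D ≃ D₂) (g : E ≃ E₂)
    (hfφ : ∀ d, f (φ d) = φ₂ (f d)) (hfα : ∀ d, f (α d) = α₂ (f d))
    (hgφ : ∀ y, g (φ' y) = φ₂' (g y)) (hgα : ∀ y, g (α' y) = α₂' (g y)) :
    Unzips φ₂ α₂ φ₂' α₂' t (f ∘ s) (((f.sumCongr (Equiv.refl _)).symm.trans h).trans g) where
  injective := f.injective.comp u.injective
  phi_inl d := by
    obtain ⟨d, rfl⟩ := f.surjective d
    simp [← hfφ, ← hgφ, u.phi_inl]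
  phi_inr i := by simp [← hgφ, u.phi_inr]
  alpha_of_notMem d hd := by
    obtain ⟨d, rfl⟩ := f.surjective d
    have : d ∉ Set.range s := by
      rintro ⟨i, rfl⟩
      exact hd ⟨i, rfl⟩
    simp [← hfα, ← hgα, u.alpha_of_notMem d this]
  alpha_inl i := by simp [← hgα, u.alpha_inl]
  alpha_inr i := by simp [← hgα, u.alpha_inr]
  alpha_apply i := by simp [← hfα, u.alpha_apply]
  involutive := u.involutive

theorem firstHit_add_one (u : Unzips φ α φ' α' t s h)
    (hc : ∀ i, FirstHit (φ * α) (Set.range s) ((φ * α) (s i)) (s (t i + 1))) (i : Fin N) :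
    FirstHit (φ * α) (Set.range s) (φ (s i)) (s (i + 1)) := by
  have := hc (t i)
  rwa [Equiv.Perm.mul_apply, u.alpha_apply, u.involutive] at this

/-- The unzipped map is determined, up to isomorphism, by the decorated map. -/
theorem right_unique (u : Unzips φ α φ' α' t s h) (u₂ : Unzips φ₂ α₂ φ₂' α₂' t₂ s₂ h₂)
    (hc : ∀ i, FirstHit (φ * α) (Set.range s) ((φ * α) (s i)) (s (t i + 1)))
    (hc₂ : ∀ i, FirstHit (φ₂ * α₂) (Set.range s₂) ((φ₂ * α₂) (s₂ i)) (s₂ (t₂ i + 1)))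
    (f : D ≃ D₂) (hfφ : ∀ d, f (φ d) = φ₂ (f d)) (hfα : ∀ d, f (α d) = α₂ (f d))
    (hS : ∀ d, d ∈ Set.range s ↔ f d ∈ Set.range s₂) (h0 : f (s 0) = s₂ 0) :
    t = t₂ ∧ ∃ g : E ≃ E₂, (∀ y, g (φ' y) = φ₂' (g y)) ∧ (∀ y, g (α' y) = α₂' (g y)) ∧
      g (h (.inr 0)) = h₂ (.inr 0) := by
  have hs : ∀ i, f (s i) = s₂ i := fun i => by
    induction i using Fin.cyclic_induction with
    | h0 => exact h0
    | hs i ih =>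
      have h1 := (u.firstHit_add_one hc i).map (σ' := φ₂ * α₂) f (by simp [hfφ, hfα]) hS
      rw [hfφ, ih] at h1
      exact h1.unique (u₂.firstHit_add_one hc₂ i)
  refine ⟨Equiv.ext fun i => u₂.injective ?_, ?_⟩
  · rw [← hs, ← u.alpha_apply, hfα, hs, u₂.alpha_apply]
  refine ⟨(h.symm.trans (f.sumCongr (Equiv.refl _))).trans h₂, ?_, ?_, by simp⟩
  · intro y
    obtain ⟨d | i, rfl⟩ := h.surjective y
    · simp [u.phi_inl, hfφ, u₂.phi_inl]
    · obtain ⟨i, rfl⟩ : ∃ j, i = j + 1 := ⟨i - 1, by simp⟩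
      simp [u.phi_inr, u₂.phi_inr]
  · intro y
    obtain ⟨d | i, rfl⟩ := h.surjective y
    · by_cases hd : d ∈ Set.range s
      · obtain ⟨i, rfl⟩ := hd
        simp [u.alpha_inl, hs, u₂.alpha_inl]
      · simp [u.alpha_of_notMem d hd, hfα, u₂.alpha_of_notMem _ (mt (hS d).2 hd)]
    · simp [u.alpha_inr, hs, u₂.alpha_inr]

/-- The glued map is determined, up to isomorphism, by the map with a boundary and the gluing. -/
theorem left_unique (u : Unzips φ α φ' α' t s h) (u₂ : Unzips φ₂ α₂ φ₂' α₂' t s₂ h₂)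
    (g : E ≃ E₂) (hgφ : ∀ y, g (φ' y) = φ₂' (g y)) (hgα : ∀ y, g (α' y) = α₂' (g y))
    (h0 : g (h (.inr 0)) = h₂ (.inr 0)) :
    ∃ f : D ≃ D₂, (∀ d, f (φ d) = φ₂ (f d)) ∧ (∀ d, f (α d) = α₂ (f d)) ∧
      ∀ i, f (s i) = s₂ i := by
  have hr : ∀ i, g (h (.inr i)) = h₂ (.inr i) := fun i => by
    induction i using Fin.cyclic_induction with
    | h0 => exact h0
    | hs i ih =>
      apply φ₂'.injective
      rw [← hgφ, u.phi_inr, u₂.phi_inr, ih]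
  have hl : ∀ d, ∃ d₂, g (h (.inl d)) = h₂ (.inl d₂) := fun d => by
    obtain ⟨i, hi⟩ | ⟨d₂, hd₂⟩ := h₂.mem_range_inr_or_exists_inl (g (h (.inl d)))
    · exact absurd (h.injective (g.injective ((hr i).trans hi))) Sum.inr_ne_inl
    · exact ⟨d₂, hd₂.symm⟩
  choose f hf using hl
  have hinj : Function.Injective f := fun d d' hdd => by
    have := hf d
    rw [hdd, ← hf d'] at this
    simpa using this
  have hsurj : Function.Surjective f := fun d₂ => by
    obtain ⟨i, hi⟩ | ⟨d, hd⟩ := h.mem_range_inr_or_exists_inl (g.symm (h₂ (.inl d₂)))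
    · rw [Equiv.eq_symm_apply, hr] at hi
      simp at hi
    · rw [Equiv.eq_symm_apply, hf] at hd
      exact ⟨d, by simpa using hd⟩
  have hfs : ∀ i, f (s i) = s₂ i := fun i => by
    have := hgα (h (.inr i))
    rw [u.alpha_inr, hr, u₂.alpha_inr, hf] at this
    simpa using this
  refine ⟨Equiv.ofBijective f ⟨hinj, hsurj⟩, fun d => ?_, fun d => ?_, hfs⟩
  · change f (φ d) = φ₂ (f d)
    have := hgφ (h (.inl d))
    rw [u.phi_inl, hf, hf, u₂.phi_inl] at this
    simpa using this
  · change f (α d) = α₂ (f d)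
    by_cases hd : d ∈ Set.range s
    · obtain ⟨i, rfl⟩ := hd
      rw [u.alpha_apply, hfs, hfs, u₂.alpha_apply]
    · have hd' : f d ∉ Set.range s₂ := by
        rintro ⟨i, hi⟩
        exact hd ⟨i, hinj (by rw [hfs, hi])⟩
      have := hgα (h (.inl d))
      rw [u.alpha_of_notMem d hd, hf, hf, u₂.alpha_of_notMem _ hd'] at this
      simpa using this

/-- Opening the edges listed by `s`. -/
theorem exists_unzip (hs : Function.Injective s) (hα : ∀ i, α (s i) = s (t i))
    (ht : ∀ i, t (t i) = i) (hinv : ∀ d, α (α d) = d) (hfix : ∀ d, α d ≠ d) :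
    ∃ φ' α' : Equiv.Perm (D ⊕ Fin N), Unzips φ α φ' α' t s (Equiv.refl _) ∧
      (∀ y, α' (α' y) = y) ∧ ∀ y, α' y ≠ y := by
  classical
  let a : D ⊕ Fin N → D ⊕ Fin N := Sum.elim
    (fun d => if hd : ∃ i, s i = d then .inr hd.choose else .inl (α d)) (fun i => .inl (s i))
  have a_s : ∀ i, a (.inl (s i)) = .inr i := fun i => by
    have hd : ∃ j, s j = s i := ⟨i, rfl⟩
    change dite _ _ _ = _
    rw [dif_pos hd, hs hd.choose_spec]
  have a_inr : ∀ i, a (.inr i) = .inl (s i) := fun i => rfl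
  have a_inl : ∀ d ∉ Set.range s, a (.inl d) = .inl (α d) := fun d hd => dif_neg hd
  have hαs : ∀ d ∉ Set.range s, α d ∉ Set.range s := by
    rintro d hd ⟨i, hi⟩
    exact hd ⟨t i, by rw [← hα, hi, hinv]⟩
  have a_inv : Function.Involutive a := by
    rintro (d | i)
    · by_cases hd : d ∈ Set.range s
      · obtain ⟨i, rfl⟩ := hd
        rw [a_s, a_inr]
      · rw [a_inl d hd, a_inl _ (hαs d hd), hinv]
    · rw [a_inr, a_s]
  refine ⟨φ.sumCongr (Equiv.addRight 1)⁻¹, a_inv.toPerm, ?_, a_inv, ?_⟩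
  · exact
      { injective := hs
        phi_inl := fun d => rfl
        phi_inr := fun i => by simp
        alpha_of_notMem := a_inl
        alpha_inl := a_s
        alpha_inr := a_inr
        alpha_apply := hα
        involutive := ht }
  · rintro (d | i) h
    · by_cases hd : d ∈ Set.range s
      · obtain ⟨i, rfl⟩ := hd
        exact Sum.inr_ne_inl ((a_s i).symm.trans h)
      · exact hfix d (Sum.inl_injective ((a_inl d hd).symm.trans h))
    · exact Sum.inl_ne_inr h

/-- Gluing the sides of a face according to `t`. -/
theorem exists_zip {b : Fin N → E} (hb : Function.Injective b) (hφ : ∀ i, φ' (b (i + 1)) = b i)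
    (hα : ∀ i j, α' (b i) ≠ b j) (hinv : ∀ d, α' (α' d) = d) (hfix : ∀ d, α' d ≠ d)
    (ht : ∀ i, t (t i) = i) (htfix : ∀ i, t i ≠ i) :
    ∃ (φ α : Equiv.Perm {x // x ∉ Set.range b}) (s : Fin N → {x // x ∉ Set.range b})
      (h : {x // x ∉ Set.range b} ⊕ Fin N ≃ E), Unzips φ α φ' α' t s h ∧
      (∀ i, h (.inr i) = b i) ∧ (∀ d, α (α d) = d) ∧ ∀ d, α d ≠ d := by
  classical
  let h : {x // x ∉ Set.range b} ⊕ Fin N ≃ E :=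
    ((Equiv.sumComm _ _).trans ((Equiv.ofInjective b hb).sumCongr (Equiv.refl _))).trans
      (Equiv.sumCompl fun x => x ∈ Set.range b)
  let s : Fin N → {x // x ∉ Set.range b} := fun i => ⟨α' (b i), fun ⟨j, hj⟩ => hα i j hj.symm⟩
  have hs : Function.Injective s := fun i j hij =>
    hb (α'.injective (congrArg Subtype.val hij))
  have hφb : ∀ x, φ' x ∉ Set.range b ↔ x ∉ Set.range b := by
    refine fun x => not_congr ⟨?_, ?_⟩
    · rintro ⟨i, hi⟩
      exact ⟨i + 1, φ'.injective (by rw [hφ, hi])⟩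
    · rintro ⟨i, rfl⟩
      refine ⟨i - 1, ?_⟩
      rw [← hφ, sub_add_cancel]
  let a : {x // x ∉ Set.range b} → {x // x ∉ Set.range b} := fun x =>
    if hx : ∃ i, b i = α' x then s (t hx.choose) else ⟨α' x, hx⟩
  have a_s : ∀ i, a (s i) = s (t i) := fun i => by
    have hx : ∃ j, b j = α' (s i) := ⟨i, (hinv _).symm⟩
    change dite _ _ _ = _
    rw [dif_pos hx, hb (hx.choose_spec.trans (hinv _))]
  have hrange : ∀ x : {x // x ∉ Set.range b}, (∃ i, b i = α' x) ↔ x ∈ Set.range s := by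
    refine fun x => ⟨?_, ?_⟩
    · rintro ⟨i, hi⟩
      exact ⟨i, Subtype.ext (by rw [← hinv x, ← hi])⟩
    · rintro ⟨i, rfl⟩
      exact ⟨i, (hinv _).symm⟩
  have a_val : ∀ x ∉ Set.range s, (a x : E) = α' x := fun x hx => by
    have hx' : ¬ ∃ i, b i = α' x := mt (hrange x).1 hx
    change ((dite _ _ _ : {x // x ∉ Set.range b}) : E) = _
    rw [dif_neg hx']
  have a_notMem : ∀ x ∉ Set.range s, a x ∉ Set.range s := fun x hx => by
    rw [← hrange, a_val x hx, hinv]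
    exact x.2
  have a_inv : Function.Involutive a := by
    intro x
    by_cases hx : x ∈ Set.range s
    · obtain ⟨i, rfl⟩ := hx
      rw [a_s, a_s, ht]
    · exact Subtype.ext (by rw [a_val _ (a_notMem x hx), a_val x hx, hinv])
  refine ⟨φ'.subtypePerm hφb, a_inv.toPerm, s, h, ?_, fun i => rfl, a_inv, ?_⟩
  · exact
      { injective := hs
        phi_inl := fun d => rfl
        phi_inr := hφ
        alpha_of_notMem := fun d hd => (a_val d hd).symm
        alpha_inl := fun i => hinv _
        alpha_inr := fun i => rfl
        alpha_apply := a_s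
        involutive := ht }
  · intro x hx
    by_cases hxs : x ∈ Set.range s
    · obtain ⟨i, rfl⟩ := hxs
      exact htfix i (hs ((a_s i).symm.trans hx))
    · exact hfix x ((a_val x hxs).symm.trans (congrArg Subtype.val hx))

end Unzips

namespace RootedMap

theorem phi_mul_alpha (M : RootedMap) : M.phi * M.alpha = M.sigma :=
  Equiv.ext fun d => congrArg M.sigma (M.alpha_invol d)

theorem jointlyTransitive (M : RootedMap) : JointlyTransitive M.phi M.alpha := by
  rintro X ⟨a, ha⟩ hφ hα x
  have hσ : ∀ x ∈ X, M.sigma x ∈ X := fun x hx => by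
    rw [← M.phi_mul_alpha]
    exact hφ _ (hα _ hx)
  obtain ⟨g, hg, rfl⟩ := M.conn a x
  suffices ∀ x, x ∈ X ↔ g x ∈ X from (this a).1 ha
  clear ha
  induction hg using Subgroup.closure_induction with
  | mem g hg =>
    have hgX : ∀ x ∈ X, g x ∈ X := by
      rcases hg with rfl | rfl
      exacts [hσ, hα]
    exact fun x => ⟨hgX x, fun hx => sameCycle_subset_of_mapsTo hgX hx
      (sameCycle_apply_left.2 (SameCycle.refl _ _))⟩
  | one => exact fun x => Iff.rfl
  | mul g g' _ _ h h' => exact fun x => (h' x).trans (h _)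
  | inv g _ h =>
    intro x
    have := h (g⁻¹ x)
    rw [show g (g⁻¹ x) = x from g.apply_symm_apply x] at this
    exact this.symm

/-- A rooted map may be specified on any finite set of darts. -/
theorem exists_equiv {D : Type*} [Finite D] {φ α : Equiv.Perm D} (hinv : ∀ d, α (α d) = d)
    (hfix : ∀ d, α d ≠ d) (h : JointlyTransitive φ α) (a : D) :
    ∃ (M : RootedMap) (e : D ≃ Fin M.nd), (∀ d, e (φ d) = M.phi (e d)) ∧
      (∀ d, e (α d) = M.alpha (e d)) ∧ e a = M.root := by
  let e := Finite.equivFin D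
  refine ⟨⟨Nat.card D, e.permCongr (φ * α), e.permCongr α, ?_, ?_, e a, ?_⟩, e, ?_, ?_, rfl⟩
  · intro d
    simp [hinv]
  · intro d hd
    refine hfix (e.symm d) (e.injective ?_)
    simpa using hd
  · intro d d'
    have hσ : ∀ x, e ((φ * α) x) = e.permCongr (φ * α) (e x) := fun x => by simp
    have hα : ∀ x, e (α x) = e.permCongr α (e x) := fun x => by simp
    have := h {x | ∃ g ∈ Subgroup.closure {e.permCongr (φ * α), e.permCongr α}, g d = e x}
      ⟨e.symm d, 1, one_mem _, by simp⟩ ?_ ?_ (e.symm d')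
    · simpa using this
    · rintro x ⟨g, hg, hgx⟩
      refine ⟨e.permCongr (φ * α) * (e.permCongr α * g),
        mul_mem (Subgroup.subset_closure (by simp))
          (mul_mem (Subgroup.subset_closure (by simp)) hg), ?_⟩
      rw [Equiv.Perm.mul_apply, Equiv.Perm.mul_apply, hgx, ← hα, ← hσ, Equiv.Perm.mul_apply, hinv]
    · rintro x ⟨g, hg, hgx⟩
      exact ⟨e.permCongr α * g, mul_mem (Subgroup.subset_closure (by simp)) hg, by
        rw [Equiv.Perm.mul_apply, hgx, hα]⟩
  · intro d
    simp [phi, hinv]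
  · intro d
    simp

/-- The rooted map `M` with boundary of length `N`, glued along `t`, gives the map `M'` decorated
by `S`. -/
def GluesTo {N : ℕ} [NeZero N] (M : RootedMap) (t : Equiv.Perm (Fin N)) (M' : RootedMap)
    (S : Finset (Fin M'.nd)) : Prop :=
  ∃ s h, Unzips M'.phi M'.alpha M.phi M.alpha t s h ∧ Set.range s = ↑S ∧ M'.root = s 0 ∧
    M.root = h (.inr 0)

theorem nd_eq {M M' : RootedMap} {N : ℕ} (h : Fin M'.nd ⊕ Fin N ≃ Fin M.nd) : M.nd = M'.nd + N := by
  simpa using (Nat.card_congr h).symm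

section Unzips

variable {M M' : RootedMap} {N : ℕ} [NeZero N] {t : Equiv.Perm (Fin N)} {s : Fin N → Fin M'.nd}
  {h : Fin M'.nd ⊕ Fin N ≃ Fin M.nd}

theorem root_sameCycle_iff (u : Unzips M'.phi M'.alpha M.phi M.alpha t s h)
    (hroot : M.root = h (.inr 0)) (d : Fin M.nd) :
    M.phi.SameCycle M.root d ↔ d ∈ Set.range fun i => h (.inr i) := by
  constructor
  · refine sameCycle_subset_of_mapsTo ?_ ⟨0, hroot.symm⟩
    rintro _ ⟨i, rfl⟩
    refine ⟨i - 1, ?_⟩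
    have := u.phi_inr (i - 1)
    rwa [sub_add_cancel, eq_comm] at this
  · rintro ⟨i, rfl⟩
    rw [hroot]
    induction i using Fin.cyclic_induction with
    | h0 => exact SameCycle.refl _ _
    | hs i ih => exact sameCycle_apply_right.1 ((u.phi_inr i).symm ▸ ih)

theorem rootFaceDegree_eq (u : Unzips M'.phi M'.alpha M.phi M.alpha t s h)
    (hroot : M.root = h (.inr 0)) : M.rootFaceDegree = N := by
  have hinr : Function.Injective fun i => h (.inr i) := fun i j hij => by simpa using hij
  rw [rootFaceDegree, faceDegreeAt, ← Nat.card_fin N,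
    ← Nat.card_congr (Equiv.ofInjective _ hinr).symm]
  exact Nat.card_congr (Equiv.subtypeEquivRight (root_sameCycle_iff u hroot))

theorem simpleBoundary_iff (u : Unzips M'.phi M'.alpha M.phi M.alpha t s h)
    (hroot : M.root = h (.inr 0)) :
    M.SimpleBoundary ↔ ∀ i, FirstHit (M'.phi * M'.alpha) (Set.range s)
      ((M'.phi * M'.alpha) (s i)) (s (t i + 1)) := by
  rw [← u.simple_iff, M.phi_mul_alpha]
  constructor
  · intro hM i j hij
    have := hM _ _ ((root_sameCycle_iff u hroot _).2 ⟨i, rfl⟩)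
      ((root_sameCycle_iff u hroot _).2 ⟨j, rfl⟩) hij
    simpa using this
  · intro hM d d' hd hd' hdd
    obtain ⟨i, rfl⟩ := (root_sameCycle_iff u hroot _).1 hd
    obtain ⟨j, rfl⟩ := (root_sameCycle_iff u hroot _).1 hd'
    rw [hM i j hdd]

theorem planar_iff {m : ℕ} (hN : N = 2 * m) (u : Unzips M'.phi M'.alpha M.phi M.alpha t s h)
    (hc : ∀ i, FirstHit (M'.phi * M'.alpha) (Set.range s)
      ((M'.phi * M'.alpha) (s i)) (s (t i + 1)))
    (hcard : Nat.card (Quot (Equiv.addRight 1 * t).SameCycle) = m + 1) :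
    M.Planar ↔ M'.Planar := by
  have h1 := u.card_faces
  have h2 := u.card_vertices hc
  rw [M.phi_mul_alpha, M'.phi_mul_alpha, hcard] at h2
  have h3 := nd_eq h
  unfold Planar vertices faces edges numCycles
  omega

theorem isTreeSub {m : ℕ} (hN : N = 2 * m) (u : Unzips M'.phi M'.alpha M.phi M.alpha t s h)
    (hc : ∀ i, FirstHit (M'.phi * M'.alpha) (Set.range s)
      ((M'.phi * M'.alpha) (s i)) (s (t i + 1)))
    (hcard : Nat.card (Quot (Equiv.addRight 1 * t).SameCycle) = m + 1)
    {S : Finset (Fin M'.nd)} (hS : Set.range s = S) : M'.IsTreeSub S ∧ S.card = 2 * m := by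
  have hmem : ∀ d, d ∈ S ↔ d ∈ Set.range s := fun d => by rw [hS, Finset.mem_coe]
  have hScard : S.card = 2 * m := by
    rw [← hN, ← Set.ncard_coe_finset, ← hS, ← Set.image_univ, Set.ncard_image_of_injective _
      u.injective, Set.ncard_univ, Nat.card_fin]
  have hsS : ∀ i, s i ∈ S := fun i => (hmem _).2 ⟨i, rfl⟩
  refine ⟨⟨?_, ?_, ?_⟩, hScard⟩
  · intro d hd
    obtain ⟨i, rfl⟩ := (hmem d).1 hd
    exact u.alpha_apply i ▸ hsS _
  · intro d hd d' hd'
    obtain ⟨i, rfl⟩ := (hmem d).1 hd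
    obtain ⟨j, rfl⟩ := (hmem d').1 hd'
    refine Fin.cyclic_induction_from (p := fun k => Relation.ReflTransGen _ (s i) (s k)) i
      Relation.ReflTransGen.refl (fun k hk => ?_) j
    refine (hk.tail ⟨hsS k, hsS (t k), .inr (u.alpha_apply k).symm⟩).tail
      ⟨hsS _, hsS _, .inl ?_⟩
    have := (hc (t k)).sameCycle
    rw [u.involutive, M'.phi_mul_alpha] at this
    exact sameCycle_apply_left.1 this
  · have := u.card_quot_range hc
    rw [hcard, hS, M'.phi_mul_alpha] at this
    rw [hScard, Nat.mul_div_cancel_left _ two_pos, ← this]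
    rfl

end Unzips

/-- Cutting a rooted map open along a tree. -/
theorem exists_gluesTo_left {m N : ℕ} [NeZero N] (hN : N = 2 * m) {M' : RootedMap}
    {S : Finset (Fin M'.nd)} (hS : M'.IsTreeSub S) (hScard : S.card = 2 * m)
    (hroot : M'.root ∈ S) :
    ∃ (t : TreeMatching N m) (M : RootedMap), M.GluesTo t.1 M' S ∧ M.SimpleBoundary := by
  obtain ⟨hα, hconn, hcount⟩ := hS
  have hα' : ∀ d, M'.alpha d ∈ S ↔ d ∈ S := fun d =>
    ⟨fun h => M'.alpha_invol d ▸ hα _ h, hα d⟩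
  obtain ⟨r, hr⟩ := exists_firstReturn M'.sigma {d | d ∈ S}
  let a : Equiv.Perm {d // d ∈ S} := M'.alpha.subtypePerm hα'
  let c : Equiv.Perm {d // d ∈ S} := a.trans r
  have hcr : ∀ d, FirstHit M'.sigma {d | d ∈ S} (M'.sigma (M'.alpha d.1)) (c d).1 :=
    fun d => hr (a d)
  have hcyc := sameCycle_contour M'.alpha_invol M'.alpha_fixfree hα hconn hcount hcr
  obtain ⟨b, hb, hbr, hb0, hbc⟩ := exists_cyclic_parametrization c ⟨M'.root, hroot⟩ (N := N) (by
    rw [Nat.card_congr (Equiv.subtypeUnivEquiv fun d => hcyc _ d), Nat.card_eq_fintype_card,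
      Fintype.card_coe, hScard, hN])
  have hbs : Function.Surjective b := fun d => by
    have : d ∈ Set.range b := by
      rw [hbr]
      exact hcyc _ d
    exact this
  let f := Equiv.ofBijective b ⟨hb, hbs⟩
  let t : Equiv.Perm (Fin N) := (f.trans a).trans f.symm
  let s : Fin N → Fin M'.nd := fun i => (b i).1
  have hs : Function.Injective s := fun i j hij => hb (Subtype.ext hij)
  have hsr : Set.range s = {d | d ∈ S} := by
    ext d
    refine ⟨?_, fun hd => ?_⟩
    · rintro ⟨i, rfl⟩
      exact (b i).2
    · obtain ⟨i, hi⟩ := hbs ⟨d, hd⟩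
      exact ⟨i, congrArg Subtype.val hi⟩
  have hbt : ∀ i, b (t i) = a (b i) := fun i => f.apply_symm_apply _
  have hst : ∀ i, M'.alpha (s i) = s (t i) := fun i => (congrArg Subtype.val (hbt i)).symm
  have ht : ∀ i, t (t i) = i := fun i => hs (by rw [← hst, ← hst, M'.alpha_invol])
  have htfix : ∀ i, t i ≠ i := fun i hi => M'.alpha_fixfree (s i) (by rw [hst, hi])
  obtain ⟨φ', α', u, hinv, hfix⟩ := Unzips.exists_unzip (φ := M'.phi) hs hst ht M'.alpha_invol
    M'.alpha_fixfree
  obtain ⟨M, e, heφ, heα, heroot⟩ := exists_equiv hinv hfix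
    (u.jointlyTransitive_unzip M'.jointlyTransitive) (.inr 0)
  have hc : ∀ i, FirstHit (M'.phi * M'.alpha) (Set.range s)
      ((M'.phi * M'.alpha) (s i)) (s (t i + 1)) := by
    intro i
    rw [M'.phi_mul_alpha, hsr]
    have := hcr (b (t i))
    rw [hbc] at this
    change FirstHit _ _ (M'.sigma (M'.alpha (s (t i)))) _ at this
    rwa [hst, ht] at this
  have u' := u.congr (φ₂ := M'.phi) (α₂ := M'.alpha) (Equiv.refl _) e (fun _ => rfl)
    (fun _ => rfl) heφ heα
  have hroot' : M.root = (((((Equiv.refl (Fin M'.nd)).sumCongr (Equiv.refl (Fin N))).symm.trans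
      (Equiv.refl _)).trans e) (.inr 0)) := heroot.symm
  have hcard : Nat.card (Quot (Equiv.addRight 1 * t).SameCycle) = m + 1 := by
    rw [← u.card_quot_range hc, hsr, M'.phi_mul_alpha]
    refine hcount.trans ?_
    rw [hScard, Nat.mul_div_cancel_left _ two_pos]
  refine ⟨⟨t, ht, htfix, hcard⟩, M, ⟨_, _, u', hsr, ?_, hroot'⟩,
    (simpleBoundary_iff u' hroot').2 hc⟩
  exact (congrArg Subtype.val hb0).symm

/-- Gluing the boundary of a rooted map into a tree. -/
theorem exists_gluesTo_right {m N : ℕ} [NeZero N] {M : RootedMap}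
    (hdeg : M.rootFaceDegree = N) (hsimple : M.SimpleBoundary) (hnd : 2 < M.nd)
    (t : TreeMatching N m) :
    ∃ (M' : RootedMap) (S : Finset (Fin M'.nd)), M.GluesTo t.1 M' S := by
  classical
  obtain ⟨t, ht, htfix, hcard⟩ := t
  obtain ⟨b, hb, hbr, hb0, hbc⟩ := exists_cyclic_parametrization M.phi⁻¹ M.root (N := N) (by
    simp_rw [sameCycle_inv]
    exact hdeg)
  have hφ : ∀ i, M.phi (b (i + 1)) = b i := fun i => by
    rw [← hbc]
    exact M.phi.apply_symm_apply _
  have hφ' : ∀ i, M.phi (b i) = b (i - 1) := fun i => by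
    rw [← hφ (i - 1), sub_add_cancel]
  have hface : ∀ i, M.phi.SameCycle M.root (b i) := fun i => by
    have : b i ∈ {d | M.phi⁻¹.SameCycle M.root d} := hbr ▸ ⟨i, rfl⟩
    exact sameCycle_inv.1 this
  have hnext : ∀ i j, M.alpha (b i) = b j → b i = b (j - 1) := fun i j hij => by
    refine hsimple _ _ (hface i) (hface _) ?_
    rw [← hφ', ← hij, sameVertex, ← M.phi_mul_alpha]
    exact sameCycle_apply_right.2 (SameCycle.refl _ _)
  have hα : ∀ i j, M.alpha (b i) ≠ b j := by
    intro i j hij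
    have hji : M.alpha (b j) = b i := by rw [← hij, M.alpha_invol]
    have hX := M.jointlyTransitive {b i, b j} ⟨_, .inl rfl⟩
      (by
        rintro _ (rfl | rfl)
        · rw [hφ', ← hnext j i hji]
          exact .inr rfl
        · rw [hφ', ← hnext i j hij]
          exact .inl rfl)
      (by
        rintro _ (rfl | rfl)
        · exact .inr hij
        · exact .inl hji)
    have h1 := Set.ncard_le_ncard (fun x _ => hX x : Set.univ ⊆ {b i, b j})
    have h2 := Set.ncard_insert_le (b i) {b j}
    rw [Set.ncard_univ, Nat.card_fin] at h1
    rw [Set.ncard_singleton] at h2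
    omega
  obtain ⟨φ, α, s, h, u, hh, hinv, hfix⟩ := Unzips.exists_zip hb hφ hα M.alpha_invol
    M.alpha_fixfree ht htfix
  have hsimple' : ∀ i j, (M.phi * M.alpha).SameCycle (h (.inr i)) (h (.inr j)) → i = j := by
    intro i j hij
    rw [M.phi_mul_alpha, hh, hh] at hij
    exact hb (hsimple _ _ (hface i) (hface j) hij)
  obtain ⟨M', e, heφ, heα, heroot⟩ := exists_equiv hinv hfix
    (u.jointlyTransitive_zip (u.simple_iff.1 hsimple') M.jointlyTransitive) (s 0)
  refine ⟨M', Finset.univ.image (e ∘ s), _, _,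
    u.congr e (Equiv.refl _) heφ heα (fun _ => rfl) fun _ => rfl, ?_, heroot.symm, ?_⟩
  · rw [Finset.coe_image, Finset.coe_univ, Set.image_univ]
  · simp [hh, hb0]

theorem Iso.refl (M : RootedMap) : M.Iso M :=
  ⟨Equiv.refl _, fun _ => rfl, fun _ => rfl, rfl⟩

theorem DecIso.refl (M : RootedMap) (S : Finset (Fin M.nd)) : DecIso M M S S :=
  ⟨Equiv.refl _, fun _ => rfl, fun _ => rfl, rfl, fun _ => Iff.rfl⟩

variable {N : ℕ} [NeZero N] {t t₂ : Equiv.Perm (Fin N)} {M M₂ M' M₂' : RootedMap}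
  {S : Finset (Fin M'.nd)} {S₂ : Finset (Fin M₂'.nd)}

theorem GluesTo.right_unique (hg : M.GluesTo t M' S) (hg₂ : M₂.GluesTo t₂ M₂' S₂)
    (hM : M.SimpleBoundary) (hM₂ : M₂.SimpleBoundary) (hiso : DecIso M' M₂' S S₂) :
    t = t₂ ∧ M.Iso M₂ := by
  obtain ⟨s, h, u, hS, h0, hroot⟩ := hg
  obtain ⟨s₂, h₂, u₂, hS₂, h0₂, hroot₂⟩ := hg₂
  obtain ⟨f, hσ, hα, hf0, hfS⟩ := hiso
  have hφ : ∀ d, f (M'.phi d) = M₂'.phi (f d) := fun d => by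
    simp only [phi, Equiv.Perm.mul_apply, hσ, hα]
  obtain ⟨htt, g, hgφ, hgα, hg0⟩ := u.right_unique u₂ ((simpleBoundary_iff u hroot).1 hM)
    ((simpleBoundary_iff u₂ hroot₂).1 hM₂) f hφ hα (fun d => by rw [hS, hS₂]; exact hfS d)
    (by rw [← h0, ← h0₂, hf0])
  refine ⟨htt, g, fun d => ?_, hgα, by rw [hroot, hroot₂, hg0]⟩
  rw [← M.phi_mul_alpha, ← M₂.phi_mul_alpha, Equiv.Perm.mul_apply, Equiv.Perm.mul_apply, hgφ, hgα]

theorem GluesTo.left_unique (hg : M.GluesTo t M' S) (hg₂ : M₂.GluesTo t M₂' S₂)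
    (hiso : M.Iso M₂) : DecIso M' M₂' S S₂ := by
  obtain ⟨s, h, u, hS, h0, hroot⟩ := hg
  obtain ⟨s₂, h₂, u₂, hS₂, h0₂, hroot₂⟩ := hg₂
  obtain ⟨g, hσ, hα, hg0⟩ := hiso
  have hφ : ∀ d, g (M.phi d) = M₂.phi (g d) := fun d => by
    simp only [phi, Equiv.Perm.mul_apply, hσ, hα]
  obtain ⟨f, hfφ, hfα, hfs⟩ := u.left_unique u₂ g hφ hα (by rw [← hroot, ← hroot₂, hg0])
  refine ⟨f, fun d => ?_, hfα, by rw [h0, h0₂, hfs], fun d => ?_⟩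
  · rw [← M'.phi_mul_alpha, ← M₂'.phi_mul_alpha, Equiv.Perm.mul_apply, Equiv.Perm.mul_apply, hfφ,
      hfα]
  · rw [← Finset.mem_coe, ← Finset.mem_coe, ← hS, ← hS₂]
    refine exists_congr fun i => ?_
    rw [← hfs, EmbeddingLike.apply_eq_iff_eq]

end RootedMap

end TreeGluing

/-- The gluing/ungluing bijection (edge version): tree-decorated rooted planar maps with
`e + m` edges, decorated by a subtree with `m` edges containing the root edge (rooted on
the tree), are in bijection with pairs of a rooted plane tree with `m` edges and a rooted
planar map with a simple boundary of perimeter `2m` and `e` interior edges (hence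
`e + 2m` edges in total). -/
theorem tree_decorated_maps_equiv_trees_times_boundary_maps_edges (e m : ℕ) :
    Nonempty
      ((Quot (fun P₁ P₂ :
          {P : Σ M : RootedMap, Finset (Fin M.nd) //
            P.1.Planar ∧ P.1.nd = 2 * (e + m) ∧ P.1.IsTreeSub P.2 ∧ P.2.card = 2 * m ∧
            P.1.root ∈ P.2} =>
          RootedMap.DecIso P₁.1.1 P₂.1.1 P₁.1.2 P₂.1.2))
        ≃ {t : PlaneTree // t.edges = m} ×
          Quot (fun M₁ M₂ :
            {M : RootedMap // M.Planar ∧ M.SimpleBoundary ∧ M.rootFaceDegree = 2 * m ∧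
              M.nd = 2 * (e + 2 * m)} =>
            RootedMap.Iso M₁.1 M₂.1)) := by
  rcases Nat.eq_zero_or_pos m with rfl | hm
  · have h₁ : IsEmpty {P : Σ M : RootedMap, Finset (Fin M.nd) //
        P.1.Planar ∧ P.1.nd = 2 * (e + 0) ∧ P.1.IsTreeSub P.2 ∧ P.2.card = 2 * 0 ∧
        P.1.root ∈ P.2} :=
      ⟨fun P => Finset.ne_empty_of_mem P.2.2.2.2.2 (Finset.card_eq_zero.1 P.2.2.2.2.1)⟩
    have h₂ : IsEmpty {M : RootedMap // M.Planar ∧ M.SimpleBoundary ∧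
        M.rootFaceDegree = 2 * 0 ∧ M.nd = 2 * (e + 2 * 0)} := by
      refine ⟨fun M => ?_⟩
      have : Nonempty {d // M.1.phi.SameCycle M.1.root d} := ⟨_, Equiv.Perm.SameCycle.refl _ _⟩
      exact Nat.card_pos.ne' M.2.2.2.1
    exact ⟨Equiv.equivOfIsEmpty _ _⟩
  obtain ⟨N, hN⟩ : ∃ N, N = 2 * m := ⟨_, rfl⟩
  have : NeZero N := ⟨by omega⟩
  obtain ⟨τ⟩ := nonempty_planeTree_equiv_treeMatching hN
  obtain ⟨F⟩ := nonempty_quot_equiv_prod_quot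
    (rA := fun P₁ P₂ : {P : Σ M : RootedMap, Finset (Fin M.nd) //
      P.1.Planar ∧ P.1.nd = 2 * (e + m) ∧ P.1.IsTreeSub P.2 ∧ P.2.card = 2 * m ∧
      P.1.root ∈ P.2} => RootedMap.DecIso P₁.1.1 P₂.1.1 P₁.1.2 P₂.1.2)
    (rB := fun M₁ M₂ : {M : RootedMap // M.Planar ∧ M.SimpleBoundary ∧
      M.rootFaceDegree = 2 * m ∧ M.nd = 2 * (e + 2 * m)} => RootedMap.Iso M₁.1 M₂.1)
    (fun P => DecIso.refl _ _) (fun M => Iso.refl _)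
    (fun P (t : TreeMatching N m) M => M.1.GluesTo t.1 P.1.1 P.1.2)
    (by
      rintro ⟨⟨M', S⟩, hplanar, hnd, htree, hcard, hroot⟩
      obtain ⟨t, M, hg, hM⟩ := exists_gluesTo_left hN htree hcard hroot
      refine ⟨t, ⟨M, ?_⟩, hg⟩
      obtain ⟨s, h, u, -, -, h0⟩ := hg
      have hnd' : M.nd = M'.nd + N := nd_eq h
      refine ⟨(planar_iff hN u ((simpleBoundary_iff u h0).1 hM) t.2.2.2).2 hplanar, hM,
        (rootFaceDegree_eq u h0).trans hN, ?_⟩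
      change M'.nd = _ at hnd
      omega)
    (by
      rintro t ⟨M, hplanar, hM, hdeg, hnd⟩
      obtain ⟨M', S, hg⟩ := exists_gluesTo_right (hdeg.trans hN.symm) hM (by omega) t
      refine ⟨⟨⟨M', S⟩, ?_⟩, hg⟩
      obtain ⟨s, h, u, hS, h0, h0'⟩ := hg
      have hnd' := nd_eq h
      have hc := (simpleBoundary_iff u h0').1 hM
      obtain ⟨h1, h2⟩ := isTreeSub hN u hc t.2.2.2 hS
      refine ⟨(planar_iff hN u hc t.2.2.2).1 hplanar, ?_, h1, h2, ?_⟩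
      · change M'.nd = _
        omega
      · rw [← Finset.mem_coe, ← hS]
        exact ⟨0, h0.symm⟩)
    (fun {_ _ _ _ M M₂} hiso hg hg₂ => by
      obtain ⟨h1, h2⟩ := hg.right_unique hg₂ M.2.2.1 M₂.2.2.1 hiso
      exact ⟨Subtype.ext h1, h2⟩)
    (fun hiso hg hg₂ => hg.left_unique hg₂ hiso)
  exact ⟨F.trans (τ.symm.prodCongr (Equiv.refl _))⟩
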